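/- arXiv:2105.12972 — 9 statements merged into one kernel-verified Lean document; each statement's English description precedes it below -/
import Mathlib

section
/- Let α be a real number with α ≠ −1, 0, 1. For every t ∈ (0,1], D_A^{(α+1)}(P‖Q_t) = (t^{2−α}/(α+1)) · d/dt ( t^{α−1} D_A^{(α)}(P‖Q_t) ). (Here the hypothesis that differentiation under the integral sign is valid, i.e., d/dt ∫ p^α q_t^{1−α} dμ = (1−α) ∫ p^α q_t^{−α}(q−p) dμ, with all these integrals finite for t ∈ (0,1], is assumed.) -/
open MeasureTheory Real Set

/-- Pointwise decomposition of the integrand `p ^ α * q_t ^ (1 - α)`; the exponent conditions make it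
hold also where `p` or `q_t` vanishes. -/
lemma rpow_mul_mix_rpow_one_sub {a b t α : ℝ} (ha : 0 ≤ a) (hmix : 0 ≤ (b - a) * t + a)
    (hαm1 : α ≠ -1) (hα1 : α ≠ 1) :
    a ^ α * ((b - a) * t + a) ^ (1 - α)
      = t * (a ^ α * ((b - a) * t + a) ^ (-α) * (b - a))
        + a ^ (α + 1) * ((b - a) * t + a) ^ (-α) := by
  have hne : α + 1 ≠ 0 := fun h => hαm1 (by linarith)
  have hne' : -α + 1 ≠ 0 := fun h => hα1 (by linarith)
  rw [show (1 : ℝ) - α = -α + 1 by ring, rpow_add_one' hmix hne', rpow_add_one' ha hne]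
  ring

/-- Theorem 1, relation (5): for `α ≠ -1, 0, 1` and `t ∈ (0,1]`,
`D_A^{(α+1)}(P‖Q_t) = (t^{2-α}/(α+1)) · d/dt ( t^{α-1} D_A^{(α)}(P‖Q_t) )`,
where `Q_t` has density `q_t = (q - p)t + p`, assuming differentiation under
the integral sign is valid and the relevant integrals are finite. -/
theorem alpha_div_derivative_relation
    {Ω : Type*} [MeasurableSpace Ω] (μ : Measure Ω) [SigmaFinite μ]
    (p q : Ω → ℝ) (hpm : Measurable p) (hqm : Measurable q)
    (hp0 : ∀ x, 0 ≤ p x) (hq0 : ∀ x, 0 ≤ q x)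
    (hpi : Integrable p μ) (hqi : Integrable q μ)
    (hp1 : ∫ x, p x ∂μ = 1) (hq1 : ∫ x, q x ∂μ = 1)
    (α : ℝ) (hαm1 : α ≠ -1) (hα0 : α ≠ 0) (hα1 : α ≠ 1)
    (hfin : ∀ t ∈ Set.Ioc (0 : ℝ) 1,
      Integrable (fun x => p x ^ α * ((q x - p x) * t + p x) ^ (1 - α)) μ ∧
      Integrable (fun x => p x ^ (α + 1) * ((q x - p x) * t + p x) ^ (-α)) μ ∧
      Integrable (fun x => p x ^ α * ((q x - p x) * t + p x) ^ (-α) * (q x - p x)) μ)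
    (hderiv : ∀ t ∈ Set.Ioc (0 : ℝ) 1,
      HasDerivAt (fun u => ∫ x, p x ^ α * ((q x - p x) * u + p x) ^ (1 - α) ∂μ)
        ((1 - α) * ∫ x, p x ^ α * ((q x - p x) * t + p x) ^ (-α) * (q x - p x) ∂μ) t)
    (t : ℝ) (ht : t ∈ Set.Ioc (0 : ℝ) 1) :
    ((α + 1) * α)⁻¹ * ((∫ x, p x ^ (α + 1) * ((q x - p x) * t + p x) ^ (-α) ∂μ) - 1)
      = t ^ (2 - α) / (α + 1) *
        deriv (fun u => u ^ (α - 1) *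
          ((α * (α - 1))⁻¹ *
            ((∫ x, p x ^ α * ((q x - p x) * u + p x) ^ (1 - α) ∂μ) - 1))) t := by
  obtain ⟨-, hH, hG⟩ := hfin t ht
  have ht0 : 0 < t := ht.1
  have hF : ∫ x, p x ^ α * ((q x - p x) * t + p x) ^ (1 - α) ∂μ
      = t * (∫ x, p x ^ α * ((q x - p x) * t + p x) ^ (-α) * (q x - p x) ∂μ)
        + ∫ x, p x ^ (α + 1) * ((q x - p x) * t + p x) ^ (-α) ∂μ := by
    rw [← integral_const_mul, ← integral_add (hG.const_mul t) hH]
    refine integral_congr_ae (.of_forall fun x => ?_)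
    have hmix : 0 ≤ (q x - p x) * t + p x := by
      nlinarith [mul_nonneg (hq0 x) ht0.le, mul_nonneg (hp0 x) (sub_nonneg.2 ht.2)]
    exact rpow_mul_mix_rpow_one_sub (hp0 x) hmix hαm1 hα1
  have hd := (hasDerivAt_rpow_const (p := α - 1) (Or.inl ht0.ne')).mul
    (((hderiv t ht).sub_const 1).const_mul (α * (α - 1))⁻¹)
  have hderiv_eq := hd.deriv
  simp only [Pi.mul_def] at hderiv_eq
  rw [hderiv_eq, hF]
  have hne : α + 1 ≠ 0 := fun h => hαm1 (by linarith)
  have hne' : α - 1 ≠ 0 := sub_ne_zero.2 hα1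
  have hpow : t ^ (α - 1) = t ^ (α - 1 - 1) * t := by
    rw [← rpow_add_one ht0.ne']
    ring_nf
  have hinv : t ^ (2 - α) * t ^ (α - 1 - 1) = 1 := by
    rw [← rpow_add ht0, show 2 - α + (α - 1 - 1) = 0 by ring, rpow_zero]
  rw [hpow]
  generalize (∫ x, p x ^ (α + 1) * ((q x - p x) * t + p x) ^ (-α) ∂μ) = H
  generalize (∫ x, p x ^ α * ((q x - p x) * t + p x) ^ (-α) * (q x - p x) ∂μ) = G
  generalize t ^ (2 - α) = A at *
  generalize t ^ (α - 1 - 1) = B at *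
  field_simp
  linear_combination (-(H - 1) * (α - 1)) * hinv
end

section
/- Let α be a real number with α ≠ −1, 0, 1. For every t ∈ (0,1], D_A^{(α)}(P_t‖Q) = (t^{2+α}/(1−α)) · d/dt ( t^{−α−1} D_A^{(α+1)}(P_t‖Q) ), assuming differentiation under the integral sign is valid and all the relevant integrals are finite for t ∈ (0,1]. -/
open MeasureTheory Real Set

/-- Splitting one factor off `a ^ (α + 1)`, where `a = d * t + b`. -/
lemma rpow_add_one_mul_rpow_neg_eq {d b t α : ℝ} (ha : 0 ≤ d * t + b) (hb : 0 ≤ b)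
    (hαm1 : α ≠ -1) (hα1 : α ≠ 1) :
    (d * t + b) ^ (α + 1) * b ^ (-α)
      = t * ((d * t + b) ^ α * b ^ (-α) * d) + (d * t + b) ^ α * b ^ (1 - α) := by
  have h1 : (d * t + b) ^ (α + 1) = (d * t + b) ^ α * (d * t + b) :=
    rpow_add_one' ha fun h => hαm1 (by linarith)
  have h2 : b ^ (1 - α) = b ^ (-α) * b := by
    rw [show 1 - α = -α + 1 by ring]
    exact rpow_add_one' hb fun h => hα1 (by linarith)
  rw [h1, h2]
  ring

/-- Theorem 1, relation (6): for `α ≠ -1, 0, 1` and `t ∈ (0,1]`,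
`D_A^{(α)}(P_t‖Q) = (t^{2+α}/(1-α)) · d/dt ( t^{-α-1} D_A^{(α+1)}(P_t‖Q) )`,
where `P_t` has density `p_t = (p - q)t + q`, assuming differentiation under
the integral sign is valid and the relevant integrals are finite. -/
theorem alpha_div_derivative_relation_dual
    {Ω : Type*} [MeasurableSpace Ω] (μ : Measure Ω) [SigmaFinite μ]
    (p q : Ω → ℝ) (hpm : Measurable p) (hqm : Measurable q)
    (hp0 : ∀ x, 0 ≤ p x) (hq0 : ∀ x, 0 ≤ q x)
    (hpi : Integrable p μ) (hqi : Integrable q μ)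
    (hp1 : ∫ x, p x ∂μ = 1) (hq1 : ∫ x, q x ∂μ = 1)
    (α : ℝ) (hαm1 : α ≠ -1) (hα0 : α ≠ 0) (hα1 : α ≠ 1)
    (hfin : ∀ t ∈ Set.Ioc (0 : ℝ) 1,
      Integrable (fun x => ((p x - q x) * t + q x) ^ α * q x ^ (1 - α)) μ ∧
      Integrable (fun x => ((p x - q x) * t + q x) ^ (α + 1) * q x ^ (-α)) μ ∧
      Integrable (fun x => ((p x - q x) * t + q x) ^ α * q x ^ (-α) * (p x - q x)) μ)
    (hderiv : ∀ t ∈ Set.Ioc (0 : ℝ) 1,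
      HasDerivAt (fun u => ∫ x, ((p x - q x) * u + q x) ^ (α + 1) * q x ^ (-α) ∂μ)
        ((α + 1) * ∫ x, ((p x - q x) * t + q x) ^ α * q x ^ (-α) * (p x - q x) ∂μ) t)
    (t : ℝ) (ht : t ∈ Set.Ioc (0 : ℝ) 1) :
    (α * (α - 1))⁻¹ * ((∫ x, ((p x - q x) * t + q x) ^ α * q x ^ (1 - α) ∂μ) - 1)
      = t ^ (2 + α) / (1 - α) *
        deriv (fun u => u ^ (-α - 1) *
          (((α + 1) * α)⁻¹ *
            ((∫ x, ((p x - q x) * u + q x) ^ (α + 1) * q x ^ (-α) ∂μ) - 1))) t := by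
  obtain ⟨ht0, ht1⟩ := ht
  obtain ⟨hA, -, hC⟩ := hfin t ⟨ht0, ht1⟩
  have hα2 : α + 1 ≠ 0 := fun h => hαm1 (by linarith)
  have hα3 : α - 1 ≠ 0 := sub_ne_zero.mpr hα1
  have hα4 : 1 - α ≠ 0 := sub_ne_zero.mpr hα1.symm
  have hsplit : ∫ x, ((p x - q x) * t + q x) ^ (α + 1) * q x ^ (-α) ∂μ
      = t * (∫ x, ((p x - q x) * t + q x) ^ α * q x ^ (-α) * (p x - q x) ∂μ)
        + ∫ x, ((p x - q x) * t + q x) ^ α * q x ^ (1 - α) ∂μ := by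
    rw [← integral_const_mul, ← integral_add (hC.const_mul t) hA]
    refine integral_congr_ae (.of_forall fun x => ?_)
    refine rpow_add_one_mul_rpow_neg_eq ?_ (hq0 x) hαm1 hα1
    nlinarith [mul_nonneg (hp0 x) ht0.le, mul_nonneg (hq0 x) (sub_nonneg.mpr ht1)]
  have hd := (hasDerivAt_rpow_const (x := t) (p := -α - 1) (Or.inl ht0.ne')).mul
    (((hderiv t ⟨ht0, ht1⟩).sub_const 1).const_mul ((α + 1) * α)⁻¹)
  have hpow1 : t ^ (2 + α) * t ^ (-α - 1 - 1) = 1 := by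
    rw [← rpow_add ht0, show 2 + α + (-α - 1 - 1) = 0 by ring, rpow_zero]
  have hpow2 : t ^ (2 + α) * t ^ (-α - 1) = t := by
    rw [← rpow_add ht0, show 2 + α + (-α - 1) = 1 by ring, rpow_one]
  refine Eq.trans ?_ (congrArg (t ^ (2 + α) / (1 - α) * ·) hd.deriv.symm)
  rw [hsplit]
  generalize ∫ x, ((p x - q x) * t + q x) ^ α * q x ^ (-α) * (p x - q x) ∂μ = C
  generalize ∫ x, ((p x - q x) * t + q x) ^ α * q x ^ (1 - α) ∂μ = A
  calc (α * (α - 1))⁻¹ * (A - 1)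
      = (1 - α)⁻¹ * (1 * (-α - 1) * (((α + 1) * α)⁻¹ * (t * C + A - 1))
          + t * (((α + 1) * α)⁻¹ * ((α + 1) * C))) := by
        field_simp
        ring
    _ = (1 - α)⁻¹ * ((t ^ (2 + α) * t ^ (-α - 1 - 1)) * (-α - 1)
            * (((α + 1) * α)⁻¹ * (t * C + A - 1))
          + (t ^ (2 + α) * t ^ (-α - 1)) * (((α + 1) * α)⁻¹ * ((α + 1) * C))) := by
        rw [hpow1, hpow2]
    _ = _ := by ring
end

section
/- For every t ∈ (0,1], (t/2) · d/dt ∫ p log(p/q_t) dμ = (1/2) ∫ (q_t − p)²/q_t dμ; equivalently, d/dt D(P‖Q_t) = (1/t) χ²_P(P‖Q_t), where χ²_P(P‖Q_t) := ∫ (p−q_t)²/q_t dμ. (Differentiation under the integral sign is assumed valid and all the relevant integrals are assumed finite for t ∈ (0,1].) -/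
open MeasureTheory Real Set

/-- The tangent-line bound `a - b ≤ a log (a / b)`. -/
lemma sub_le_mul_log_div {a b : ℝ} (ha : 0 ≤ a) (hb : 0 ≤ b) (hab : 0 < a → 0 < b) :
    a - b ≤ a * Real.log (a / b) := by
  rcases ha.eq_or_lt with rfl | ha'
  · simpa using hb
  · have hb' := hab ha'
    have h := mul_le_mul_of_nonneg_left (Real.one_sub_inv_le_log_of_pos (div_pos ha' hb')) ha
    have e : a * (1 - (a / b)⁻¹) = a - b := by field_simp
    linarith

/-- If the divergence from `p` to the mixture `(q - p) u + p` is finite for `u ∈ (0, 1)` and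
continuous at `u = 1`, then `p` vanishes almost everywhere on the zero set of `q`. -/
lemma ae_eq_zero_of_continuousAt_integral_mul_log
    {Ω : Type*} [MeasurableSpace Ω] {μ : Measure Ω} {p q : Ω → ℝ} (hqm : Measurable q)
    (hp0 : ∀ x, 0 ≤ p x) (hq0 : ∀ x, 0 ≤ q x)
    (hpi : Integrable p μ) (hqi : Integrable q μ) (hpq : ∫ x, p x ∂μ = ∫ x, q x ∂μ)
    (hfin : ∀ u ∈ Set.Ioo (0 : ℝ) 1,
      Integrable (fun x => p x * Real.log (p x / ((q x - p x) * u + p x))) μ)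
    (hcont : ContinuousAt
      (fun u => ∫ x, p x * Real.log (p x / ((q x - p x) * u + p x)) ∂μ) 1) :
    ∀ᵐ x ∂μ, q x = 0 → p x = 0 := by
  set A : Set Ω := {x | q x = 0} with hA
  have hAm : MeasurableSet A := hqm (measurableSet_singleton 0)
  have hAi : Integrable (A.indicator p) μ := hpi.indicator hAm
  have hA0 : ∀ x, 0 ≤ A.indicator p x := fun x => Set.indicator_nonneg (fun y _ => hp0 y) x
  have lower : ∀ u ∈ Set.Ioo (0 : ℝ) 1, (-Real.log (1 - u) - u) * ∫ x, A.indicator p x ∂μ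
      ≤ ∫ x, p x * Real.log (p x / ((q x - p x) * u + p x)) ∂μ := by
    intro u hu
    have hi : Integrable (fun x => u * (p x - q x)) μ := (hpi.sub hqi).const_mul u
    have hj : Integrable (fun x => (-Real.log (1 - u) - u) * A.indicator p x) μ :=
      hAi.const_mul _
    have h0 : ∫ x, u * (p x - q x) ∂μ = 0 := by
      rw [integral_const_mul, integral_sub hpi hqi, hpq, sub_self, mul_zero]
    calc (-Real.log (1 - u) - u) * ∫ x, A.indicator p x ∂μ
        = ∫ x, (u * (p x - q x) + (-Real.log (1 - u) - u) * A.indicator p x) ∂μ := by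
          rw [integral_add hi hj, h0, integral_const_mul, zero_add]
      _ ≤ _ := by
          refine integral_mono (hi.add hj) (hfin u hu) fun x => ?_
          have h1u : 0 < 1 - u := sub_pos.2 hu.2
          by_cases hx : x ∈ A
          · have hqx : q x = 0 := hx
            simp only [Set.indicator_of_mem hx, hqx]
            rcases (hp0 x).eq_or_lt with hp | hp
            · simp [← hp]
            · have e : p x / ((0 - p x) * u + p x) = (1 - u)⁻¹ := by
                rw [show (0 - p x) * u + p x = p x * (1 - u) by ring]
                field_simp
              rw [e, Real.log_inv]
              linarith
          · simp only [Set.indicator_of_notMem hx, mul_zero, add_zero]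
            have e : (q x - p x) * u + p x = q x * u + p x * (1 - u) := by ring
            have hqu := mul_nonneg (hq0 x) hu.1.le
            have h := sub_le_mul_log_div (hp0 x)
              (b := (q x - p x) * u + p x)
              (by rw [e]; exact add_nonneg hqu (mul_nonneg (hp0 x) h1u.le))
              (fun hp => by rw [e]; exact add_pos_of_nonneg_of_pos hqu (mul_pos hp h1u))
            linarith
  have hzero : ∫ x, A.indicator p x ∂μ = 0 := by
    by_contra hne
    have hpos : 0 < ∫ x, A.indicator p x ∂μ :=
      lt_of_le_of_ne (integral_nonneg hA0) (Ne.symm hne)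
    have hsub : Filter.Tendsto (fun u : ℝ => 1 - u) (nhdsWithin 1 (Set.Iio 1))
        (nhdsWithin 0 (Set.Ioi 0)) := by
      refine tendsto_nhdsWithin_iff.2 ⟨?_, ?_⟩
      · have : ContinuousAt (fun u : ℝ => 1 - u) 1 := by fun_prop
        simpa [ContinuousAt] using this.tendsto.mono_left nhdsWithin_le_nhds
      · filter_upwards [self_mem_nhdsWithin] with u hu
        exact Set.mem_Ioi.2 (sub_pos.2 (Set.mem_Iio.1 hu))
    have hlog : Filter.Tendsto (fun u : ℝ => -Real.log (1 - u)) (nhdsWithin 1 (Set.Iio 1))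
        Filter.atTop :=
      Filter.tendsto_neg_atBot_atTop.comp (Real.tendsto_log_nhdsGT_zero.comp hsub)
    have hid : Filter.Tendsto (fun u : ℝ => -u) (nhdsWithin 1 (Set.Iio 1)) (nhds (-1)) :=
      (continuous_neg.tendsto (1 : ℝ)).mono_left nhdsWithin_le_nhds
    have hbot := (hlog.atTop_add hid).atTop_mul_const hpos
    refine not_tendsto_nhds_of_tendsto_atTop (Filter.tendsto_atTop_mono' _ ?_ hbot) _
      (hcont.tendsto.mono_left nhdsWithin_le_nhds)
    filter_upwards [Ioo_mem_nhdsLT (zero_lt_one : (0 : ℝ) < 1)] with u hu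
    simpa only [sub_eq_add_neg] using lower u hu
  filter_upwards [(integral_eq_zero_iff_of_nonneg hA0 hAi).1 hzero] with x hx hqx
  have hxA : x ∈ A := hqx
  simpa [Set.indicator_of_mem hxA] using hx

/-- For `t ∈ (0,1]`, `(t/2) · d/dt ∫ p log(p/q_t) dμ = (1/2) ∫ (q_t - p)²/q_t dμ`;
equivalently `d/dt D(P‖Q_t) = (1/t) χ²_P(P‖Q_t)`, where `q_t = (q - p)t + p`,
assuming differentiation under the integral sign is valid and the relevant
integrals are finite. -/
theorem kl_chi2_derivative_relation
    {Ω : Type*} [MeasurableSpace Ω] (μ : Measure Ω) [SigmaFinite μ]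
    (p q : Ω → ℝ) (hpm : Measurable p) (hqm : Measurable q)
    (hp0 : ∀ x, 0 ≤ p x) (hq0 : ∀ x, 0 ≤ q x)
    (hpi : Integrable p μ) (hqi : Integrable q μ)
    (hp1 : ∫ x, p x ∂μ = 1) (hq1 : ∫ x, q x ∂μ = 1)
    (hfin : ∀ t ∈ Set.Ioc (0 : ℝ) 1,
      Integrable (fun x => p x * Real.log (p x / ((q x - p x) * t + p x))) μ ∧
      Integrable (fun x => (((q x - p x) * t + p x) - p x) ^ 2 / ((q x - p x) * t + p x)) μ ∧
      Integrable (fun x => p x * (p x - q x) / ((q x - p x) * t + p x)) μ)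
    (hderiv : ∀ t ∈ Set.Ioc (0 : ℝ) 1,
      HasDerivAt (fun u => ∫ x, p x * Real.log (p x / ((q x - p x) * u + p x)) ∂μ)
        (∫ x, p x * (p x - q x) / ((q x - p x) * t + p x) ∂μ) t)
    (t : ℝ) (ht : t ∈ Set.Ioc (0 : ℝ) 1) :
    t / 2 * deriv (fun u => ∫ x, p x * Real.log (p x / ((q x - p x) * u + p x)) ∂μ) t
      = (1 / 2) * ∫ x, (((q x - p x) * t + p x) - p x) ^ 2 / ((q x - p x) * t + p x) ∂μ
    ∧ deriv (fun u => ∫ x, p x * Real.log (p x / ((q x - p x) * u + p x)) ∂μ) t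
      = t⁻¹ * ∫ x, (p x - ((q x - p x) * t + p x)) ^ 2 / ((q x - p x) * t + p x) ∂μ := by
  have hac := ae_eq_zero_of_continuousAt_integral_mul_log hqm hp0 hq0 hpi hqi (hp1.trans hq1.symm)
    (fun u hu => (hfin u ⟨hu.1, hu.2.le⟩).1) (hderiv 1 ⟨one_pos, le_rfl⟩).continuousAt
  have ht0 : 0 < t := ht.1
  have hkey : t * ∫ x, p x * (p x - q x) / ((q x - p x) * t + p x) ∂μ
      = ∫ x, (((q x - p x) * t + p x) - p x) ^ 2 / ((q x - p x) * t + p x) ∂μ := by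
    have hi : Integrable (fun x => t * (p x - q x)) μ := (hpi.sub hqi).const_mul t
    have h0 : ∫ x, t * (p x - q x) ∂μ = 0 := by
      rw [integral_const_mul, integral_sub hpi hqi, hp1, hq1, sub_self, mul_zero]
    rw [← integral_const_mul, ← zero_add (∫ x, _ / _ ∂μ), ← h0,
      ← integral_add hi (hfin t ht).2.1]
    refine integral_congr_ae ?_
    filter_upwards [hac] with x hx
    by_cases hd : (q x - p x) * t + p x = 0
    · have e : q x * t + p x * (1 - t) = 0 := by linarith
      have h1 := mul_nonneg (hq0 x) ht0.le
      have h2 := mul_nonneg (hp0 x) (sub_nonneg.2 ht.2)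
      have hqx : q x = 0 := by
        have h3 : q x * t = 0 := by linarith
        exact (mul_eq_zero.1 h3).resolve_right ht0.ne'
      simp [hqx, hx hqx]
    · rw [← mul_div_assoc, add_div' _ _ _ hd]
      congr 1
      ring
  have hsq : ∫ x, (p x - ((q x - p x) * t + p x)) ^ 2 / ((q x - p x) * t + p x) ∂μ
      = ∫ x, (((q x - p x) * t + p x) - p x) ^ 2 / ((q x - p x) * t + p x) ∂μ := by
    simp only [sub_sq_comm (p _)]
  rw [(hderiv t ht).deriv, hsq, ← hkey]
  refine ⟨by ring, ?_⟩
  rw [inv_mul_cancel_left₀ ht0.ne']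
end

section
/- For every t ∈ (0,1], t² · d/dt ( t^{−1} ∫ q_t log(q_t/p) dμ ) = ∫ p log(p/q_t) dμ; that is, t² · d/dt ( t^{−1} D(Q_t‖P) ) = D(P‖Q_t). (Differentiation under the integral sign is assumed valid and all the relevant integrals are assumed finite for t ∈ (0,1].) -/
open MeasureTheory Real Set

/-- For `t ∈ (0,1]`, `t² · d/dt ( t⁻¹ ∫ q_t log(q_t/p) dμ ) = ∫ p log(p/q_t) dμ`,
that is, `t² · d/dt ( t⁻¹ D(Q_t‖P) ) = D(P‖Q_t)`, where `q_t = (q - p)t + p`,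
assuming differentiation under the integral sign is valid and the relevant
integrals are finite. -/
theorem kl_reverse_derivative_relation
    {Ω : Type*} [MeasurableSpace Ω] (μ : Measure Ω) [SigmaFinite μ]
    (p q : Ω → ℝ) (hpm : Measurable p) (hqm : Measurable q)
    (hp0 : ∀ x, 0 ≤ p x) (hq0 : ∀ x, 0 ≤ q x)
    (hpi : Integrable p μ) (hqi : Integrable q μ)
    (hp1 : ∫ x, p x ∂μ = 1) (hq1 : ∫ x, q x ∂μ = 1)
    (hfin : ∀ t ∈ Set.Ioc (0 : ℝ) 1,
      Integrable (fun x =>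
        ((q x - p x) * t + p x) * Real.log (((q x - p x) * t + p x) / p x)) μ ∧
      Integrable (fun x => p x * Real.log (p x / ((q x - p x) * t + p x))) μ ∧
      Integrable (fun x => (q x - p x) * Real.log (((q x - p x) * t + p x) / p x)) μ)
    (hderiv : ∀ t ∈ Set.Ioc (0 : ℝ) 1,
      HasDerivAt
        (fun u => ∫ x, ((q x - p x) * u + p x) * Real.log (((q x - p x) * u + p x) / p x) ∂μ)
        (∫ x, (q x - p x) * (Real.log (((q x - p x) * t + p x) / p x) + 1) ∂μ) t)
    (t : ℝ) (ht : t ∈ Set.Ioc (0 : ℝ) 1) :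
    t ^ 2 * deriv (fun u =>
        u⁻¹ * ∫ x, ((q x - p x) * u + p x) * Real.log (((q x - p x) * u + p x) / p x) ∂μ) t
      = ∫ x, p x * Real.log (p x / ((q x - p x) * t + p x)) ∂μ := by
  obtain ⟨h_klQP, -, h_score⟩ := hfin t ht
  have ht0 : t ≠ 0 := ht.1.ne'
  have h_diff : Integrable (fun x => q x - p x) μ := hqi.sub hpi
  have h_mass : ∫ x, (q x - p x) ∂μ = 0 := by
    rw [integral_sub hqi hpi, hp1, hq1, sub_self]
  have h_split : ∫ x, (q x - p x) * (Real.log (((q x - p x) * t + p x) / p x) + 1) ∂μ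
      = ∫ x, (q x - p x) * Real.log (((q x - p x) * t + p x) / p x) ∂μ := by
    simp only [mul_add, mul_one]
    rw [integral_add h_score h_diff, h_mass, add_zero]
  have h_klPQ : ∫ x, p x * Real.log (p x / ((q x - p x) * t + p x)) ∂μ
      = t * ∫ x, (q x - p x) * Real.log (((q x - p x) * t + p x) / p x) ∂μ
        - ∫ x, ((q x - p x) * t + p x) * Real.log (((q x - p x) * t + p x) / p x) ∂μ := by
    rw [← integral_const_mul, ← integral_sub (h_score.const_mul t) h_klQP]
    refine integral_congr_ae (.of_forall fun x => ?_)
    dsimp only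
    rw [← inv_div, Real.log_inv]
    ring
  rw [((hasDerivAt_inv ht0).fun_mul (hderiv t ht)).deriv, h_split, h_klPQ]
  field_simp
  ring
end

section
/- Let α ∈ [−1,2] and let P, Q be Borel probability measures on ℝ with finite second moments, means m_P ≠ m_Q, and variances σ_P², σ_Q². Then D_A^{(α)}(P‖Q) ≥ d_A^{(α)}(r‖s), where r and s are defined from (m_P, σ_P, m_Q, σ_Q) as in the context. -/
open MeasureTheory Real Set

/-- `v := (1/(2|a|))√((σ_Q²−σ_P²)² + 2a²(σ_P²+σ_Q²) + a⁴)` with `a = m_P − m_Q`. -/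
noncomputable def vParam (mP mQ σP σQ : ℝ) : ℝ :=
  (1 / (2 * |mP - mQ|)) *
    Real.sqrt ((σQ ^ 2 - σP ^ 2) ^ 2 + 2 * (mP - mQ) ^ 2 * (σP ^ 2 + σQ ^ 2) + (mP - mQ) ^ 4)

/-- `r := 1/2 + (σ_Q²−σ_P²+a²)/(4av)`. -/
noncomputable def rParam (mP mQ σP σQ : ℝ) : ℝ :=
  1 / 2 + (σQ ^ 2 - σP ^ 2 + (mP - mQ) ^ 2) / (4 * (mP - mQ) * vParam mP mQ σP σQ)

/-- `s := 1/2 + (σ_Q²−σ_P²−a²)/(4av)`. -/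
noncomputable def sParam (mP mQ σP σQ : ℝ) : ℝ :=
  1 / 2 + (σQ ^ 2 - σP ^ 2 - (mP - mQ) ^ 2) / (4 * (mP - mQ) * vParam mP mQ σP σQ)

/-- The `α`-divergence `D_A^{(α)}(P‖Q)` of Borel probability measures on `ℝ`,
computed with the dominating measure `P + Q` and Radon–Nikodym densities
(the value of the defining integral is invariant in the dominating measure). -/
noncomputable def DA (α : ℝ) (P Q : Measure ℝ) : ℝ :=
  if α = 0 then
    ∫ x, (Q.rnDeriv (P + Q) x).toReal *
      Real.log ((Q.rnDeriv (P + Q) x).toReal / (P.rnDeriv (P + Q) x).toReal) ∂(P + Q)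
  else if α = 1 then
    ∫ x, (P.rnDeriv (P + Q) x).toReal *
      Real.log ((P.rnDeriv (P + Q) x).toReal / (Q.rnDeriv (P + Q) x).toReal) ∂(P + Q)
  else
    (α * (α - 1))⁻¹ *
      ((∫ x, (P.rnDeriv (P + Q) x).toReal ^ α * (Q.rnDeriv (P + Q) x).toReal ^ (1 - α)
        ∂(P + Q)) - 1)

/-- The binary `α`-divergence `d_A^{(α)}(r‖s)`. -/
noncomputable def dA (α r s : ℝ) : ℝ :=
  if α = 0 then s * Real.log (s / r) + (1 - s) * Real.log ((1 - s) / (1 - r))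
  else if α = 1 then r * Real.log (r / s) + (1 - r) * Real.log ((1 - r) / (1 - s))
  else (α * (α - 1))⁻¹ *
    (r ^ α * s ^ (1 - α) + (1 - r) ^ α * (1 - s) ^ (1 - α) - 1)

open Filter Topology in
/-- Second-order Taylor formula on `[0, 1]` with nonnegative second derivative, as a lower integral. -/
lemma lintegral_one_sub_mul_deriv2 {F F' F'' : ℝ → ℝ}
    (h1 : ∀ y ∈ Icc (0 : ℝ) 1, HasDerivAt F (F' y) y)
    (h2 : ∀ y ∈ Icc (0 : ℝ) 1, HasDerivAt F' (F'' y) y)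
    (hc : ContinuousOn F'' (Icc 0 1)) (h0 : ∀ y ∈ Icc (0 : ℝ) 1, 0 ≤ F'' y) :
    ∫⁻ y in Ioc (0 : ℝ) 1, ENNReal.ofReal ((1 - y) * F'' y)
      = ENNReal.ofReal (F 1 - F 0 - F' 0) := by
  have hco : ContinuousOn (fun y => (1 - y) * F'' y) (Icc 0 1) := by fun_prop
  have hi : IntervalIntegrable (fun y => (1 - y) * F'' y) volume 0 1 := by
    apply ContinuousOn.intervalIntegrable
    rwa [uIcc_of_le zero_le_one]
  rw [← ofReal_integral_eq_lintegral_ofReal, ← intervalIntegral.integral_of_le zero_le_one,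
    intervalIntegral.integral_eq_sub_of_hasDerivAt
      (f := fun y => (1 - y) * F' y + F y) _ hi]
  · congr 1; ring
  · intro y hy
    rw [uIcc_of_le zero_le_one] at hy
    have := (((hasDerivAt_id y).const_sub 1).mul (h2 y hy)).add (h1 y hy)
    exact this.congr_deriv (by simp)
  · exact (intervalIntegrable_iff_integrableOn_Ioc_of_le zero_le_one).1 hi
  · filter_upwards [ae_restrict_mem measurableSet_Ioc] with y hy
    exact mul_nonneg (by linarith [hy.2]) (h0 y ⟨hy.1.le, hy.2⟩)

lemma integrableOn_rpow_div_add_pow_three {α z : ℝ} (hα : α ∈ Ioo (0 : ℝ) 2) (hz : 0 < z) :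
    IntegrableOn (fun u : ℝ => 2 * u ^ α / (z + u) ^ 3) (Ioi 0) := by
  have h := (integrableOn_add_rpow_Ioi_of_lt (a := α - 3) (c := 0) (m := z)
    (by linarith [hα.2]) (by linarith)).const_mul 2
  refine Integrable.mono' h (Measurable.aestronglyMeasurable (by fun_prop)) ?_
  filter_upwards [ae_restrict_mem measurableSet_Ioi] with u hu
  have hu : 0 < u := hu
  have hzu : 0 < z + u := by positivity
  rw [Real.norm_of_nonneg (by positivity), mul_div_assoc, add_comm u z,
    Real.rpow_sub hzu, show (3 : ℝ) = ((3 : ℕ) : ℝ) by norm_num, Real.rpow_natCast]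
  gcongr
  · exact hα.1.le
  · linarith

/-- Normalising constant of the Stieltjes-type representation of the `α`-divergence. -/
noncomputable def stieltjesConst (α : ℝ) : ℝ := ∫ u in Ioi (0 : ℝ), 2 * u ^ α / (1 + u) ^ 3

lemma stieltjesConst_pos {α : ℝ} (hα : α ∈ Ioo (0 : ℝ) 2) : 0 < stieltjesConst α := by
  unfold stieltjesConst
  rw [setIntegral_pos_iff_support_of_nonneg_ae]
  · refine lt_of_lt_of_le ?_ (measure_mono (s := Ioi (0 : ℝ)) ?_)
    · simp
    · intro u hu
      have hu' : 0 < u := hu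
      exact ⟨(by positivity : (0 : ℝ) < 2 * u ^ α / (1 + u) ^ 3).ne', hu⟩
  · filter_upwards [ae_restrict_mem measurableSet_Ioi] with u hu
    have hu : 0 < u := hu
    simp only [Pi.zero_apply]
    positivity
  · exact integrableOn_rpow_div_add_pow_three hα one_pos

lemma lintegral_rpow_div_add_pow_three {α z : ℝ} (hα : α ∈ Ioo (0 : ℝ) 2) (hz : 0 < z) :
    ∫⁻ u in Ioi (0 : ℝ), ENNReal.ofReal (2 * u ^ α / (z + u) ^ 3)
      = ENNReal.ofReal (stieltjesConst α * z ^ (α - 2)) := by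
  rw [← ofReal_integral_eq_lintegral_ofReal (integrableOn_rpow_div_add_pow_three hα hz)]
  · congr 1
    have h := integral_comp_mul_left_Ioi (fun u : ℝ => 2 * u ^ α / (z + u) ^ 3) 0 hz
    rw [mul_zero, smul_eq_mul] at h
    have h2 : ∫ u in Ioi (0 : ℝ), 2 * (z * u) ^ α / (z + z * u) ^ 3
        = z ^ (α - 3) * stieltjesConst α := by
      rw [stieltjesConst, ← integral_const_mul]
      refine setIntegral_congr_fun measurableSet_Ioi fun u hu => ?_
      have hu : 0 < u := hu
      rw [Real.mul_rpow hz.le hu.le, Real.rpow_sub hz,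
        show (3 : ℝ) = ((3 : ℕ) : ℝ) by norm_num, Real.rpow_natCast]
      field_simp
    rw [h2, eq_inv_mul_iff_mul_eq₀ hz.ne'] at h
    rw [← h, show α - 2 = α - 3 + 1 by ring, Real.rpow_add hz, Real.rpow_one]
    ring
  · filter_upwards [ae_restrict_mem measurableSet_Ioi] with u hu
    have hu : 0 < u := hu
    simp only [Pi.zero_apply]
    positivity

/-- The `α`-divergence integrand, normalised to be nonnegative by adding an affine term. -/
noncomputable def alphaKernel (α p q : ℝ) : ℝ :=
  if α = 1 then p * Real.log (p / q) - p + q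
  else (α * (α - 1))⁻¹ * (p ^ α * q ^ (1 - α) - α * p - (1 - α) * q)

/-- The second derivative of `alphaKernel α · 1` is `z ↦ z ^ (α - 2)`. -/
lemma alphaKernel_lintegral_segment {α t : ℝ} (hα : α ∈ Ioo (0 : ℝ) 2) (ht : 0 < t) :
    ∫⁻ y in Ioc (0 : ℝ) 1,
      ENNReal.ofReal ((1 - y) * ((t - 1) ^ 2 * (1 + y * (t - 1)) ^ (α - 2)))
      = ENNReal.ofReal (alphaKernel α t 1) := by
  have hpos : ∀ y ∈ Icc (0 : ℝ) 1, 0 < 1 + y * (t - 1) := by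
    intro y hy
    rcases eq_or_lt_of_le hy.2 with h | h
    · subst h; linarith
    · nlinarith [hy.1, mul_nonneg hy.1 ht.le]
  have hd : ∀ y, HasDerivAt (fun y : ℝ => 1 + y * (t - 1)) (t - 1) y := fun y => by
    simpa using ((hasDerivAt_id y).mul_const (t - 1)).const_add 1
  have hc : ContinuousOn (fun y : ℝ => (t - 1) ^ 2 * (1 + y * (t - 1)) ^ (α - 2)) (Icc 0 1) := by
    refine continuousOn_const.mul (ContinuousOn.rpow_const (by fun_prop) fun y hy => ?_)
    exact Or.inl (hpos y hy).ne'
  have h0 : ∀ y ∈ Icc (0 : ℝ) 1, 0 ≤ (t - 1) ^ 2 * (1 + y * (t - 1)) ^ (α - 2) :=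
    fun y hy => mul_nonneg (sq_nonneg _) (Real.rpow_nonneg (hpos y hy).le _)
  have hα0 := hα.1
  by_cases h1 : α = 1
  · subst h1
    rw [lintegral_one_sub_mul_deriv2
      (F := fun y => (1 + y * (t - 1)) * Real.log (1 + y * (t - 1)) - (1 + y * (t - 1)))
      (F' := fun y => (t - 1) * Real.log (1 + y * (t - 1))) _ _ hc h0]
    · simp [alphaKernel]
    · intro y hy
      have hp := (hpos y hy).ne'
      refine HasDerivAt.congr_deriv (((hd y).mul ((hd y).log hp)).sub (hd y)) ?_
      rw [mul_div_cancel₀ _ hp]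
      ring
    · intro y hy
      have hp := (hpos y hy).ne'
      refine HasDerivAt.congr_deriv (((hd y).log hp).const_mul (t - 1)) ?_
      norm_num [Real.rpow_neg_one]
      field_simp
  · have hα1 : α - 1 ≠ 0 := sub_ne_zero.2 h1
    rw [lintegral_one_sub_mul_deriv2
      (F := fun y => (α * (α - 1))⁻¹ * (1 + y * (t - 1)) ^ α)
      (F' := fun y => (α - 1)⁻¹ * (t - 1) * (1 + y * (t - 1)) ^ (α - 1)) _ _ hc h0]
    · simp [alphaKernel, h1]
      field_simp
      ring_nf
    · intro y hy
      have hp := (hpos y hy).ne'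
      refine HasDerivAt.congr_deriv (((hd y).rpow_const (p := α) (Or.inl hp)).const_mul (α * (α - 1))⁻¹) ?_
      field_simp
    · intro y hy
      have hp := (hpos y hy).ne'
      refine HasDerivAt.congr_deriv (((hd y).rpow_const (p := α - 1) (Or.inl hp)).const_mul ((α - 1)⁻¹ * (t - 1))) ?_
      rw [show α - 1 - 1 = α - 2 by ring]
      field_simp

lemma sq_div_eq_lintegral_segment {t u : ℝ} (ht : 0 < t) (hu : 0 < u) :
    ENNReal.ofReal (((t - 1) ^ 2) / ((1 + u) ^ 2 * (t + u))) =
      ∫⁻ y in Ioc (0 : ℝ) 1,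
        ENNReal.ofReal ((1 - y) * (2 * (t - 1) ^ 2 / (1 + y * (t - 1) + u) ^ 3)) := by
  have hpos : ∀ y ∈ Icc (0 : ℝ) 1, 0 < 1 + y * (t - 1) + u := by
    intro y hy
    nlinarith [hy.1, hy.2, mul_nonneg hy.1 ht.le]
  have hd : ∀ y, HasDerivAt (fun y : ℝ => 1 + y * (t - 1) + u) (t - 1) y := fun y => by
    simpa using (((hasDerivAt_id y).mul_const (t - 1)).const_add 1).add_const u
  rw [lintegral_one_sub_mul_deriv2
    (F := fun y => (1 + y * (t - 1) + u)⁻¹)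
    (F' := fun y => -(t - 1) * ((1 + y * (t - 1) + u) ^ 2)⁻¹)]
  · congr 1
    have : t + u ≠ 0 := by positivity
    rw [show 1 + 1 * (t - 1) + u = t + u by ring, show 1 + 0 * (t - 1) + u = 1 + u by ring]
    field_simp
    ring
  · intro y hy
    have hp := (hpos y hy).ne'
    refine HasDerivAt.congr_deriv ((hd y).inv hp) ?_
    field_simp
  · intro y hy
    have hp := (hpos y hy).ne'
    refine HasDerivAt.congr_deriv ((((hd y).pow 2).inv (pow_ne_zero 2 hp)).const_mul (-(t - 1))) ?_
    simp only [Pi.pow_apply]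
    generalize 1 + y * (t - 1) + u = w at hp ⊢
    field_simp
    norm_num
    ring
  · refine ContinuousOn.div (by fun_prop) (by fun_prop) fun y hy => ?_
    exact pow_ne_zero 3 (hpos y hy).ne'
  · intro y hy
    have hp := hpos y hy
    positivity

lemma stieltjes_alphaKernel_one {α t : ℝ} (hα : α ∈ Ioo (0 : ℝ) 2) (ht : 0 < t) :
    ∫⁻ u in Ioi (0 : ℝ), ENNReal.ofReal (u ^ α / (1 + u) ^ 2 * ((t - 1) ^ 2 / (t + u)))
      = ENNReal.ofReal (stieltjesConst α) * ENNReal.ofReal (alphaKernel α t 1) := by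
  have hpos : ∀ y ∈ Ioc (0 : ℝ) 1, 0 < 1 + y * (t - 1) := by
    intro y hy
    rcases eq_or_lt_of_le hy.2 with h | h
    · subst h; linarith
    · nlinarith [hy.1, mul_nonneg hy.1.le ht.le]
  have hC := (stieltjesConst_pos hα).le
  calc _ = ∫⁻ u in Ioi (0 : ℝ), ∫⁻ y in Ioc (0 : ℝ) 1, ENNReal.ofReal (u ^ α) *
        ENNReal.ofReal ((1 - y) * (2 * (t - 1) ^ 2 / (1 + y * (t - 1) + u) ^ 3)) := by
        refine setLIntegral_congr_fun measurableSet_Ioi fun u hu => ?_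
        have hu : 0 < u := hu
        rw [lintegral_const_mul _ (by fun_prop), ← sq_div_eq_lintegral_segment ht hu,
          ← ENNReal.ofReal_mul (by positivity)]
        congr 1
        field_simp
    _ = ∫⁻ y in Ioc (0 : ℝ) 1, ∫⁻ u in Ioi (0 : ℝ), ENNReal.ofReal (u ^ α) *
        ENNReal.ofReal ((1 - y) * (2 * (t - 1) ^ 2 / (1 + y * (t - 1) + u) ^ 3)) := by
        refine lintegral_lintegral_swap (Measurable.aemeasurable ?_)
        unfold Function.uncurry
        fun_prop
    _ = ∫⁻ y in Ioc (0 : ℝ) 1, ENNReal.ofReal (stieltjesConst α) *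
        ENNReal.ofReal ((1 - y) * ((t - 1) ^ 2 * (1 + y * (t - 1)) ^ (α - 2))) := by
        refine setLIntegral_congr_fun measurableSet_Ioc fun y hy => ?_
        have hz := hpos y hy
        have hy1 : 0 ≤ 1 - y := by linarith [hy.2]
        rw [← ENNReal.ofReal_mul hC, show stieltjesConst α *
            ((1 - y) * ((t - 1) ^ 2 * (1 + y * (t - 1)) ^ (α - 2))) = (1 - y) * (t - 1) ^ 2 *
            (stieltjesConst α * (1 + y * (t - 1)) ^ (α - 2)) by ring,
          ENNReal.ofReal_mul (by positivity), ← lintegral_rpow_div_add_pow_three hα hz,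
          ← lintegral_const_mul _ (by fun_prop)]
        refine setLIntegral_congr_fun measurableSet_Ioi fun u hu => ?_
        have hu : 0 < u := hu
        rw [← ENNReal.ofReal_mul (by positivity), ← ENNReal.ofReal_mul (by positivity)]
        congr 1
        ring
    _ = _ := by
        rw [lintegral_const_mul _ (by fun_prop), alphaKernel_lintegral_segment hα ht]

lemma alphaKernel_eq_mul {α p q : ℝ} (hp : 0 < p) (hq : 0 < q) :
    alphaKernel α p q = q * alphaKernel α (p / q) 1 := by
  unfold alphaKernel
  split_ifs with h
  · rw [div_one]
    field_simp
  · rw [Real.div_rpow hp.le hq.le, Real.rpow_sub hq, Real.rpow_one, Real.one_rpow]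
    field_simp

lemma stieltjes_alphaKernel_of_pos {α p q : ℝ} (hα : α ∈ Ioo (0 : ℝ) 2)
    (hp : 0 < p) (hq : 0 < q) :
    ∫⁻ u in Ioi (0 : ℝ), ENNReal.ofReal (u ^ α / (1 + u) ^ 2 * ((p - q) ^ 2 / (p + u * q)))
      = ENNReal.ofReal (stieltjesConst α) * ENNReal.ofReal (alphaKernel α p q) := by
  rw [alphaKernel_eq_mul hp hq, ENNReal.ofReal_mul hq.le, mul_left_comm,
    ← stieltjes_alphaKernel_one hα (div_pos hp hq), ← lintegral_const_mul _ (by fun_prop)]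
  refine setLIntegral_congr_fun measurableSet_Ioi fun u hu => ?_
  have hu : 0 < u := hu
  rw [← ENNReal.ofReal_mul hq.le]
  congr 1
  field_simp

open Filter Topology in
lemma tendsto_alphaKernel_add {α p q : ℝ} (hα : 0 < α)
    (h : 1 ≤ α → q ≠ 0) :
    Tendsto (fun ε => alphaKernel α (p + ε) (q + ε)) (𝓝 0) (𝓝 (alphaKernel α p q)) := by
  have hp : Tendsto (fun ε : ℝ => p + ε) (𝓝 0) (𝓝 p) := by
    simpa using (continuous_const_add p).tendsto (0 : ℝ)
  have hq : Tendsto (fun ε : ℝ => q + ε) (𝓝 0) (𝓝 q) := by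
    simpa using (continuous_const_add q).tendsto (0 : ℝ)
  unfold alphaKernel
  split_ifs with h1
  · have hq0 : q ≠ 0 := h h1.ge
    have key : ∀ x y : ℝ, y ≠ 0 →
        x * Real.log (x / y) - x + y = x * Real.log x - x * Real.log y - x + y := by
      intro x y hy
      rcases eq_or_ne x 0 with rfl | hx
      · simp
      · rw [Real.log_div hx hy]; ring
    rw [key p q hq0]
    have hev : ∀ᶠ ε : ℝ in 𝓝 0, q + ε ≠ 0 := hq.eventually_ne hq0
    refine Tendsto.congr' (hev.mono fun ε hε => (key _ _ hε).symm) ?_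
    exact (((Real.continuous_mul_log.tendsto p).comp hp).sub
      (hp.mul (hq.log hq0))).sub hp |>.add hq
  · refine Tendsto.const_mul _ (((Tendsto.mul ?_ ?_).sub (hp.const_mul _)).sub (hq.const_mul _))
    · exact hp.rpow_const (Or.inr hα.le)
    · refine hq.rpow_const ?_
      rcases le_or_gt 1 α with h2 | h2
      · exact Or.inl (h h2)
      · exact Or.inr (by linarith)

open Filter Topology in
/-- Representation of the `α`-divergence integrand as a mixture of `χ²`-type integrands. -/
lemma stieltjes_alphaKernel {α p q : ℝ} (hα : α ∈ Ioo (0 : ℝ) 2)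
    (hp : 0 ≤ p) (hq : 0 ≤ q) (h : 1 ≤ α → q = 0 → p = 0) :
    ∫⁻ u in Ioi (0 : ℝ), ENNReal.ofReal (u ^ α / (1 + u) ^ 2 * ((p - q) ^ 2 / (p + u * q)))
      = ENNReal.ofReal (stieltjesConst α) * ENNReal.ofReal (alphaKernel α p q) := by
  by_cases h00 : p = 0 ∧ q = 0
  · obtain ⟨rfl, rfl⟩ := h00
    simp [alphaKernel, hα.1.ne']
  have hq' : 1 ≤ α → q ≠ 0 := fun h1 h2 => h00 ⟨h h1 h2, h2⟩
  let ε : ℕ → ℝ := fun n => 1 / ((n : ℝ) + 1)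
  have hε : Tendsto ε atTop (𝓝 0) := tendsto_one_div_add_atTop_nhds_zero_nat
  have hε0 : ∀ n, 0 < ε n := fun n => Nat.one_div_pos_of_nat
  have hanti : Antitone ε := fun m n hmn => Nat.one_div_le_one_div hmn
  have hR : Tendsto (fun n => ENNReal.ofReal (stieltjesConst α) *
      ENNReal.ofReal (alphaKernel α (p + ε n) (q + ε n))) atTop
      (𝓝 (ENNReal.ofReal (stieltjesConst α) * ENNReal.ofReal (alphaKernel α p q))) :=
    ENNReal.Tendsto.const_mul (ENNReal.tendsto_ofReal ((tendsto_alphaKernel_add hα.1 hq').comp hε))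
      (Or.inr ENNReal.ofReal_ne_top)
  refine tendsto_nhds_unique ?_ hR
  simp_rw [← fun n => stieltjes_alphaKernel_of_pos hα (add_pos_of_nonneg_of_pos hp (hε0 n))
    (add_pos_of_nonneg_of_pos hq (hε0 n))]
  have hden : ∀ u : ℝ, 0 < u → 0 < p + u * q := by
    intro u hu
    rcases hp.lt_or_eq with hp' | hp'
    · positivity
    · have : 0 < q := hq.lt_of_ne fun h => h00 ⟨hp'.symm, h.symm⟩
      positivity
  refine lintegral_tendsto_of_tendsto_of_monotone (fun n => by fun_prop) ?_ ?_
  · filter_upwards [ae_restrict_mem measurableSet_Ioi] with u hu m n hmn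
    have hu : 0 < u := hu
    have h1 := hden u hu
    have h2 := hanti hmn
    have h3 := hε0 n
    apply ENNReal.ofReal_le_ofReal
    simp only [add_sub_add_right_eq_sub]
    have h4 : 0 < p + ε n + u * (q + ε n) := by nlinarith [mul_pos hu h3]
    gcongr
  · filter_upwards [ae_restrict_mem measurableSet_Ioi] with u hu
    have hu : 0 < u := hu
    have h1 := hden u hu
    refine ENNReal.tendsto_ofReal (Tendsto.const_mul _ ?_)
    simp only [add_sub_add_right_eq_sub]
    refine Tendsto.div tendsto_const_nhds ?_ h1.ne'
    simpa using (hε.const_add p).add ((hε.const_add q).const_mul u)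

lemma ofReal_integral_le_lintegral_ofReal {X : Type*} [MeasurableSpace X] {μ : Measure X}
    {g : X → ℝ} (hg : Integrable g μ) :
    ENNReal.ofReal (∫ x, g x ∂μ) ≤ ∫⁻ x, ENNReal.ofReal (g x) ∂μ := by
  have h := ofReal_integral_eq_lintegral_ofReal hg.pos_part
    (Filter.Eventually.of_forall fun x => le_max_right _ _)
  calc ENNReal.ofReal (∫ x, g x ∂μ) ≤ ENNReal.ofReal (∫ x, max (g x) 0 ∂μ) :=
        ENNReal.ofReal_le_ofReal (integral_mono hg hg.pos_part fun x => le_max_left _ _)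
    _ = _ := by
        rw [h]
        refine lintegral_congr fun x => ?_
        rcases le_total (g x) 0 with h | h <;> simp [h, ENNReal.ofReal_of_nonpos]

section Moments

variable {P : Measure ℝ} [IsProbabilityMeasure P] {m V : ℝ}

lemma integrable_id_of_sq (h2 : Integrable (fun x => x ^ 2) P) :
    Integrable (fun x : ℝ => x) P :=
  ((memLp_two_iff_integrable_sq (by fun_prop)).2 h2).integrable (by norm_num)

lemma integrable_affine (h2 : Integrable (fun x => x ^ 2) P) (k c : ℝ) :
    Integrable (fun x => k * (x - c)) P :=
  ((integrable_id_of_sq h2).sub (integrable_const c)).const_mul k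

lemma integral_affine (h2 : Integrable (fun x => x ^ 2) P) (hm : ∫ x, x ∂P = m) (k c : ℝ) :
    ∫ x, k * (x - c) ∂P = k * (m - c) := by
  rw [integral_const_mul, integral_sub (integrable_id_of_sq h2) (integrable_const c), hm]
  simp

lemma integrable_affine_sq (h2 : Integrable (fun x => x ^ 2) P) (k c : ℝ) :
    Integrable (fun x => (k * (x - c)) ^ 2) P := by
  have h := ((h2.sub ((integrable_id_of_sq h2).const_mul (2 * c))).add
    (integrable_const (c ^ 2))).const_mul (k ^ 2)
  refine h.congr (Filter.Eventually.of_forall fun x => ?_)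
  simp only [Pi.add_apply, Pi.sub_apply]
  ring

lemma integral_affine_sq (h2 : Integrable (fun x => x ^ 2) P) (hm : ∫ x, x ∂P = m)
    (hV : ∫ x, (x - m) ^ 2 ∂P = V) (k c : ℝ) :
    ∫ x, (k * (x - c)) ^ 2 ∂P = k ^ 2 * (V + (m - c) ^ 2) := by
  have h1 : Integrable (fun x => k ^ 2 * (x - m) ^ 2) P := by
    simpa [mul_pow] using integrable_affine_sq h2 k m
  have h3 := integrable_affine h2 (2 * k ^ 2 * (m - c)) m
  have e : ∀ x : ℝ, (k * (x - c)) ^ 2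
      = k ^ 2 * (x - m) ^ 2 + 2 * k ^ 2 * (m - c) * (x - m) + k ^ 2 * (m - c) ^ 2 := fun x => by
    ring
  simp_rw [e]
  have h13 : Integrable (fun x => k ^ 2 * (x - m) ^ 2 + 2 * k ^ 2 * (m - c) * (x - m)) P :=
    h1.add h3
  rw [integral_add h13 (integrable_const _), integral_add h1 h3, integral_const_mul, hV,
    integral_affine h2 hm]
  simp
  ring

/-- A distribution on `ℝ` whose mean differs from that of some `P' ≪ P` is not degenerate. -/
lemma variance_pos_of_absolutelyContinuous {P' : Measure ℝ} [IsProbabilityMeasure P'] {m' : ℝ}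
    (h2 : Integrable (fun x => x ^ 2) P) (hm : ∫ x, x ∂P' = m') (hne : m' ≠ m)
    (hV : ∫ x, (x - m) ^ 2 ∂P = V) (hac : P' ≪ P) : 0 < V := by
  have hnn : 0 ≤ V := hV ▸ integral_nonneg fun x => sq_nonneg _
  refine hnn.lt_of_ne fun h0 => hne ?_
  have hi : Integrable (fun x => (x - m) ^ 2) P := by
    simpa using integrable_affine_sq h2 1 m
  rw [← h0, integral_eq_zero_iff_of_nonneg (fun x => sq_nonneg _) hi] at hV
  have h_const : (fun x : ℝ => x) =ᵐ[P'] fun _ => m := by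
    filter_upwards [hac.ae_le hV] with x hx
    have : (x - m) ^ 2 = 0 := hx
    nlinarith [pow_eq_zero_iff (two_ne_zero) |>.1 this]
  rw [← hm, integral_congr_ae h_const]
  simp

end Moments

/-- Hammersley–Chapman–Robbins bound for `∫ (p - q)² / (A p + B q)`. -/
lemma ofReal_le_lintegral_sq_div {P Q μ : Measure ℝ} [IsProbabilityMeasure P]
    [IsProbabilityMeasure Q] [SigmaFinite μ] (hPμ : P ≪ μ) (hQμ : Q ≪ μ)
    {mP mQ VP VQ A B S : ℝ}
    (hP2 : Integrable (fun x => x ^ 2) P) (hQ2 : Integrable (fun x => x ^ 2) Q)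
    (hmP : ∫ x, x ∂P = mP) (hmQ : ∫ x, x ∂Q = mQ)
    (hvP : ∫ x, (x - mP) ^ 2 ∂P = VP) (hvQ : ∫ x, (x - mQ) ^ 2 ∂Q = VQ)
    (hA : 0 ≤ A) (hB : 0 ≤ B) (hAB : 0 < A + B)
    (hS : S = A * VP + B * VQ + A * B * (mP - mQ) ^ 2 / (A + B)) (hS0 : 0 < S)
    (h0 : ∀ᵐ x ∂μ, A * (P.rnDeriv μ x).toReal + B * (Q.rnDeriv μ x).toReal = 0 →
      (P.rnDeriv μ x).toReal = (Q.rnDeriv μ x).toReal) :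
    ENNReal.ofReal ((mP - mQ) ^ 2 / S) ≤
      ∫⁻ x, ENNReal.ofReal (((P.rnDeriv μ x).toReal - (Q.rnDeriv μ x).toReal) ^ 2 /
        (A * (P.rnDeriv μ x).toReal + B * (Q.rnDeriv μ x).toReal)) ∂μ := by
  set c := (A * mP + B * mQ) / (A + B) with hc
  set k := (mP - mQ) / S with hk
  let f : ℝ → ℝ := fun x => 2 * (k * (x - c)) - A * (k * (x - c)) ^ 2
  let g : ℝ → ℝ := fun x => 2 * (k * (x - c)) + B * (k * (x - c)) ^ 2
  have hf : Integrable f P :=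
    ((integrable_affine hP2 k c).const_mul 2).sub ((integrable_affine_sq hP2 k c).const_mul A)
  have hg : Integrable g Q :=
    ((integrable_affine hQ2 k c).const_mul 2).add ((integrable_affine_sq hQ2 k c).const_mul B)
  have hf' := (integrable_rnDeriv_smul_iff hPμ).2 hf
  have hg' := (integrable_rnDeriv_smul_iff hQμ).2 hg
  have hval : ∫ x, ((P.rnDeriv μ x).toReal • f x - (Q.rnDeriv μ x).toReal • g x) ∂μ
      = (mP - mQ) ^ 2 / S := by
    have hfi : ∫ x, f x ∂P = 2 * (k * (mP - c)) - A * (k ^ 2 * (VP + (mP - c) ^ 2)) := by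
      rw [integral_sub ((integrable_affine hP2 k c).const_mul 2)
        ((integrable_affine_sq hP2 k c).const_mul A), integral_const_mul 2, integral_const_mul A,
        integral_affine hP2 hmP, integral_affine_sq hP2 hmP hvP]
    have hgi : ∫ x, g x ∂Q = 2 * (k * (mQ - c)) + B * (k ^ 2 * (VQ + (mQ - c) ^ 2)) := by
      rw [integral_add ((integrable_affine hQ2 k c).const_mul 2)
        ((integrable_affine_sq hQ2 k c).const_mul B), integral_const_mul 2, integral_const_mul B,
        integral_affine hQ2 hmQ, integral_affine_sq hQ2 hmQ hvQ]
    rw [integral_sub hf' hg', integral_rnDeriv_smul hPμ, integral_rnDeriv_smul hQμ, hfi, hgi]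
    have hS' : A * (VP + (mP - c) ^ 2) + B * (VQ + (mQ - c) ^ 2) = S := by
      rw [hS, hc]
      field_simp
      ring
    have hkS : k * S = mP - mQ := by rw [hk]; field_simp
    calc _ = 2 * k * (mP - mQ)
          - k ^ 2 * (A * (VP + (mP - c) ^ 2) + B * (VQ + (mQ - c) ^ 2)) := by ring
      _ = k * (mP - mQ) := by rw [hS', ← hkS]; ring
      _ = _ := by rw [hk]; ring
  have hfg : Integrable
      (fun x => (P.rnDeriv μ x).toReal • f x - (Q.rnDeriv μ x).toReal • g x) μ := hf'.sub hg'
  rw [← hval]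
  refine (ofReal_integral_le_lintegral_ofReal hfg).trans (lintegral_mono_ae ?_)
  filter_upwards [h0] with x hx
  apply ENNReal.ofReal_le_ofReal
  have hp : 0 ≤ (P.rnDeriv μ x).toReal := ENNReal.toReal_nonneg
  have hq : 0 ≤ (Q.rnDeriv μ x).toReal := ENNReal.toReal_nonneg
  simp only [smul_eq_mul, f, g]
  generalize (P.rnDeriv μ x).toReal = p at *
  generalize (Q.rnDeriv μ x).toReal = q at *
  generalize k * (x - c) = w
  have hn : 0 ≤ A * p + B * q := by positivity
  rcases hn.lt_or_eq with hpos | hz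
  · rw [le_div_iff₀ hpos]
    nlinarith [sq_nonneg ((p - q) - w * (A * p + B * q))]
  · have hpq := hx hz.symm
    subst hpq
    rw [sub_self, ← hz]
    norm_num
    linear_combination w ^ 2 * hz

section Params

variable {mP mQ σP σQ : ℝ}

lemma vParam_pos (hm : mP ≠ mQ) : 0 < vParam mP mQ σP σQ := by
  have ha : mP - mQ ≠ 0 := sub_ne_zero.2 hm
  unfold vParam
  positivity

lemma vParam_sq (hm : mP ≠ mQ) : 4 * (mP - mQ) ^ 2 * vParam mP mQ σP σQ ^ 2 =
    (σQ ^ 2 - σP ^ 2) ^ 2 + 2 * (mP - mQ) ^ 2 * (σP ^ 2 + σQ ^ 2) + (mP - mQ) ^ 4 := by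
  have ha : mP - mQ ≠ 0 := sub_ne_zero.2 hm
  unfold vParam
  rw [mul_pow, Real.sq_sqrt (by positivity), div_pow, mul_pow, sq_abs]
  field_simp
  norm_num

lemma rParam_sub_sParam (hm : mP ≠ mQ) :
    rParam mP mQ σP σQ - sParam mP mQ σP σQ = (mP - mQ) / (2 * vParam mP mQ σP σQ) := by
  have ha : mP - mQ ≠ 0 := sub_ne_zero.2 hm
  have hv := (vParam_pos (σP := σP) (σQ := σQ) hm).ne'
  unfold rParam sParam
  field_simp
  ring

lemma rParam_mul_one_sub (hm : mP ≠ mQ) :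
    rParam mP mQ σP σQ * (1 - rParam mP mQ σP σQ) = σP ^ 2 / (4 * vParam mP mQ σP σQ ^ 2) := by
  have ha : mP - mQ ≠ 0 := sub_ne_zero.2 hm
  have hv := (vParam_pos (σP := σP) (σQ := σQ) hm).ne'
  have h := vParam_sq (σP := σP) (σQ := σQ) hm
  unfold rParam
  generalize vParam mP mQ σP σQ = v at *
  generalize mP - mQ = a at *
  field_simp
  linear_combination 4 * h

lemma rParam_swap (hm : mP ≠ mQ) : rParam mQ mP σQ σP = sParam mP mQ σP σQ := by
  have hv : vParam mQ mP σQ σP = vParam mP mQ σP σQ := by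
    unfold vParam
    rw [abs_sub_comm mQ mP]
    congr 2
    ring
  have ha : mP - mQ ≠ 0 := sub_ne_zero.2 hm
  have hv0 := (vParam_pos (σP := σP) (σQ := σQ) hm).ne'
  unfold rParam sParam
  rw [hv, ← neg_sub mP mQ]
  field_simp
  ring

lemma sParam_swap (hm : mP ≠ mQ) : sParam mQ mP σQ σP = rParam mP mQ σP σQ :=
  (rParam_swap hm.symm).symm

lemma sParam_mul_one_sub (hm : mP ≠ mQ) :
    sParam mP mQ σP σQ * (1 - sParam mP mQ σP σQ) = σQ ^ 2 / (4 * vParam mP mQ σP σQ ^ 2) := by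
  have ha : mP - mQ ≠ 0 := sub_ne_zero.2 hm
  have hv := (vParam_pos (σP := σP) (σQ := σQ) hm).ne'
  have h := vParam_sq (σP := σP) (σQ := σQ) hm
  unfold sParam
  generalize vParam mP mQ σP σQ = v at *
  generalize mP - mQ = a at *
  field_simp
  linear_combination 4 * h

lemma mem_Icc_of_mul_one_sub_nonneg {x : ℝ} (h : 0 ≤ x * (1 - x)) : x ∈ Icc (0 : ℝ) 1 := by
  constructor <;> nlinarith

lemma rParam_mem_Icc (hm : mP ≠ mQ) : rParam mP mQ σP σQ ∈ Icc (0 : ℝ) 1 :=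
  mem_Icc_of_mul_one_sub_nonneg (rParam_mul_one_sub hm ▸ by positivity)

lemma sParam_mem_Icc (hm : mP ≠ mQ) : sParam mP mQ σP σQ ∈ Icc (0 : ℝ) 1 :=
  mem_Icc_of_mul_one_sub_nonneg (sParam_mul_one_sub hm ▸ by positivity)

lemma sParam_mem_Ioo (hm : mP ≠ mQ) (hσ : 0 < σQ ^ 2) : sParam mP mQ σP σQ ∈ Ioo (0 : ℝ) 1 := by
  have hv := vParam_pos (σP := σP) (σQ := σQ) hm
  have h : 0 < sParam mP mQ σP σQ * (1 - sParam mP mQ σP σQ) := by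
    rw [sParam_mul_one_sub hm]
    positivity
  have h1 := sParam_mem_Icc (σP := σP) (σQ := σQ) hm
  constructor
  · exact h1.1.lt_of_ne fun h0 => by simp [← h0] at h
  · exact h1.2.lt_of_ne fun h0 => by simp [h0] at h

/-- The binary distributions attain the Hammersley–Chapman–Robbins bound. -/
lemma binary_sq_div (hm : mP ≠ mQ) {A B S : ℝ} (hAB : 0 < A + B)
    (hS : S = A * σP ^ 2 + B * σQ ^ 2 + A * B * (mP - mQ) ^ 2 / (A + B)) (hS0 : 0 < S) :
    (rParam mP mQ σP σQ - sParam mP mQ σP σQ) ^ 2 /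
        (A * rParam mP mQ σP σQ + B * sParam mP mQ σP σQ) +
      ((1 - rParam mP mQ σP σQ) - (1 - sParam mP mQ σP σQ)) ^ 2 /
        (A * (1 - rParam mP mQ σP σQ) + B * (1 - sParam mP mQ σP σQ)) =
      (mP - mQ) ^ 2 / S := by
  have hv := vParam_pos (σP := σP) (σQ := σQ) hm
  have h1 := rParam_sub_sParam (σP := σP) (σQ := σQ) hm
  have h2 := rParam_mul_one_sub (σP := σP) (σQ := σQ) hm
  have h3 := sParam_mul_one_sub (σP := σP) (σQ := σQ) hm
  generalize vParam mP mQ σP σQ = v at *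
  generalize rParam mP mQ σP σQ = r at *
  generalize sParam mP mQ σP σQ = s at *
  have hprod : (A * r + B * s) * (A * (1 - r) + B * (1 - s)) = (A + B) * S / (4 * v ^ 2) := by
    calc _ = (A + B) * (A * (r * (1 - r)) + B * (s * (1 - s))) + A * B * (r - s) ^ 2 := by ring
      _ = _ := by
        rw [h1, h2, h3, hS]
        field_simp
        ring
  have hne : (A * r + B * s) * (A * (1 - r) + B * (1 - s)) ≠ 0 := by
    rw [hprod]
    positivity
  have hne1 := left_ne_zero_of_mul hne
  have hne2 := right_ne_zero_of_mul hne
  have e : (1 - r) - (1 - s) = -(r - s) := by ring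
  rw [e, neg_sq, div_add_div _ _ hne1 hne2, hprod, h1]
  rw [show ((mP - mQ) / (2 * v)) ^ 2 * (A * (1 - r) + B * (1 - s)) +
    (A * r + B * s) * ((mP - mQ) / (2 * v)) ^ 2 = ((mP - mQ) / (2 * v)) ^ 2 * (A + B) by ring]
  field_simp
  norm_num

end Params

lemma rnDeriv_eq_zero_of_absolutelyContinuous {P Q μ : Measure ℝ} [SigmaFinite P]
    [SigmaFinite Q] [SigmaFinite μ] (h : P ≪ Q) :
    ∀ᵐ x ∂μ, (Q.rnDeriv μ x).toReal = 0 → (P.rnDeriv μ x).toReal = 0 := by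
  filter_upwards [Measure.rnDeriv_mul_rnDeriv (κ := μ) h, Q.rnDeriv_lt_top μ] with x hx hx2 h0
  have : Q.rnDeriv μ x = 0 := (ENNReal.toReal_eq_zero_iff _).1 h0 |>.resolve_right hx2.ne
  rw [← hx, Pi.mul_apply, this, mul_zero, ENNReal.toReal_zero]

lemma DA_swap (α : ℝ) (P Q : Measure ℝ) : DA (1 - α) Q P = DA α P Q := by
  unfold DA
  rw [add_comm Q P]
  rcases eq_or_ne α 0 with rfl | h0
  · simp
  rcases eq_or_ne α 1 with rfl | h1
  · simp
  have h2 : 1 - α ≠ 0 := sub_ne_zero.2 h1.symm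
  rw [if_neg h2, if_neg (by simpa using h0), if_neg h0, if_neg h1]
  simp_rw [mul_comm (_ ^ (1 - α)), sub_sub_cancel]
  congr 2
  ring

lemma dA_swap (α r s : ℝ) : dA (1 - α) s r = dA α r s := by
  unfold dA
  rcases eq_or_ne α 0 with rfl | h0
  · simp
  rcases eq_or_ne α 1 with rfl | h1
  · simp
  have h2 : 1 - α ≠ 0 := sub_ne_zero.2 h1.symm
  rw [if_neg h2, if_neg (by simpa using h0), if_neg h0, if_neg h1, sub_sub_cancel]
  rw [mul_comm (s ^ _), mul_comm ((1 - s) ^ _)]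
  congr 2
  ring

lemma dA_eq_alphaKernel {α r s : ℝ} (hα : 0 < α) :
    dA α r s = alphaKernel α r s + alphaKernel α (1 - r) (1 - s) := by
  unfold dA alphaKernel
  rw [if_neg hα.ne']
  split_ifs <;> ring

/-- The integrand of `DA` at densities `p` and `q`, for `α ≠ 0`. -/
noncomputable def alphaIntegrand (α p q : ℝ) : ℝ :=
  if α = 1 then p * Real.log (p / q) else p ^ α * q ^ (1 - α)

lemma DA_eq_integral_alphaKernel {α : ℝ} (hα : 0 < α) (P Q : Measure ℝ)
    [IsProbabilityMeasure P] [IsProbabilityMeasure Q]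
    (hint : Integrable (fun x => alphaIntegrand α (P.rnDeriv (P + Q) x).toReal
      (Q.rnDeriv (P + Q) x).toReal) (P + Q)) :
    Integrable (fun x => alphaKernel α (P.rnDeriv (P + Q) x).toReal
      (Q.rnDeriv (P + Q) x).toReal) (P + Q) ∧
    ∫ x, alphaKernel α (P.rnDeriv (P + Q) x).toReal (Q.rnDeriv (P + Q) x).toReal ∂(P + Q)
      = DA α P Q := by
  have hPi : Integrable (fun x => (P.rnDeriv (P + Q) x).toReal) (P + Q) :=
    Measure.integrable_toReal_rnDeriv
  have hQi : Integrable (fun x => (Q.rnDeriv (P + Q) x).toReal) (P + Q) :=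
    Measure.integrable_toReal_rnDeriv
  have hP1 : ∫ x, (P.rnDeriv (P + Q) x).toReal ∂(P + Q) = 1 := by
    rw [Measure.integral_toReal_rnDeriv (Measure.absolutelyContinuous_of_le (Measure.le_add_right le_rfl))]
    simp
  have hQ1 : ∫ x, (Q.rnDeriv (P + Q) x).toReal ∂(P + Q) = 1 := by
    rw [Measure.integral_toReal_rnDeriv (Measure.absolutelyContinuous_of_le (Measure.le_add_left le_rfl))]
    simp
  unfold DA alphaKernel
  unfold alphaIntegrand at hint
  rw [if_neg hα.ne']
  split_ifs at hint ⊢ with h1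
  · refine ⟨(hint.sub hPi).add hQi, ?_⟩
    have h' : Integrable (fun x => (P.rnDeriv (P + Q) x).toReal * Real.log
      ((P.rnDeriv (P + Q) x).toReal / (Q.rnDeriv (P + Q) x).toReal) -
      (P.rnDeriv (P + Q) x).toReal) (P + Q) := hint.sub hPi
    rw [integral_add h' hQi, hQ1, integral_sub hint hPi, hP1]
    ring
  · have h' : Integrable (fun x => (P.rnDeriv (P + Q) x).toReal ^ α *
      (Q.rnDeriv (P + Q) x).toReal ^ (1 - α) - α * (P.rnDeriv (P + Q) x).toReal) (P + Q) :=
      hint.sub (hPi.const_mul α)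
    refine ⟨(h'.sub (hQi.const_mul (1 - α))).const_mul _, ?_⟩
    rw [integral_const_mul, integral_sub h' (hQi.const_mul (1 - α)),
      integral_sub hint (hPi.const_mul α), integral_const_mul α, integral_const_mul (1 - α),
      hP1, hQ1]
    ring

lemma alphaKernel_two {p q : ℝ} (h : q = 0 → p = 0) :
    alphaKernel 2 p q = (p - q) ^ 2 / (2 * q) := by
  unfold alphaKernel
  rw [if_neg (by norm_num), show (1 - 2 : ℝ) = -1 by norm_num, Real.rpow_neg_one,
    show (2 : ℝ) = ((2 : ℕ) : ℝ) by norm_num, Real.rpow_natCast]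
  rcases eq_or_ne q 0 with rfl | hq
  · simp [h rfl]
  · field_simp
    norm_num
    ring

lemma alphaKernel_nonneg_of_pos {α p q : ℝ} (hα : 0 < α) (hp : 0 < p) (hq : 0 < q) :
    0 ≤ alphaKernel α p q := by
  rw [alphaKernel_eq_mul hp hq]
  refine mul_nonneg hq.le ?_
  have ht : 0 < p / q := div_pos hp hq
  generalize p / q = t at ht
  unfold alphaKernel
  split_ifs with h1
  · have h := Real.one_sub_inv_le_log_of_pos ht
    have h2 := mul_le_mul_of_nonneg_left h ht.le
    rw [mul_sub, mul_inv_cancel₀ ht.ne'] at h2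
    rw [div_one]
    linarith
  · rw [Real.one_rpow]
    rcases lt_or_gt_of_ne h1 with h | h
    · have hb := rpow_one_add_le_one_add_mul_self (s := t - 1) (by linarith) hα.le h.le
      rw [add_sub_cancel] at hb
      refine mul_nonneg_of_nonpos_of_nonpos ?_ (by linarith)
      exact inv_nonpos.2 (mul_nonpos_of_nonneg_of_nonpos hα.le (by linarith))
    · have hb := one_add_mul_self_le_rpow_one_add (s := t - 1) (by linarith) h.le
      rw [add_sub_cancel] at hb
      refine mul_nonneg ?_ (by linarith)
      exact inv_nonneg.2 (mul_nonneg hα.le (by linarith))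

open Filter Topology in
lemma alphaKernel_nonneg {α p q : ℝ} (hα : 0 < α)
    (hp : 0 ≤ p) (hq : 0 ≤ q) (h : 1 ≤ α → q = 0 → p = 0) : 0 ≤ alphaKernel α p q := by
  by_cases h00 : p = 0 ∧ q = 0
  · obtain ⟨rfl, rfl⟩ := h00
    simp [alphaKernel, hα.ne']
  have hq' : 1 ≤ α → q ≠ 0 := fun h1 h2 => h00 ⟨h h1 h2, h2⟩
  refine ge_of_tendsto ((tendsto_alphaKernel_add hα hq').mono_left
    (nhdsWithin_le_nhds (s := Ioi (0 : ℝ)))) ?_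
  filter_upwards [self_mem_nhdsWithin] with ε hε
  exact alphaKernel_nonneg_of_pos hα (add_pos_of_nonneg_of_pos hp hε)
    (add_pos_of_nonneg_of_pos hq hε)

/-- The lower bound for `0 < α ≤ 2`. -/
lemma dA_le_DA_of_pos {α : ℝ} (hα : α ∈ Ioc (0 : ℝ) 2)
    (P Q : Measure ℝ) [IsProbabilityMeasure P] [IsProbabilityMeasure Q]
    (hP2 : Integrable (fun x => x ^ 2) P) (hQ2 : Integrable (fun x => x ^ 2) Q)
    {mP mQ σP σQ : ℝ} (hm : mP ≠ mQ)
    (hmP : ∫ x, x ∂P = mP) (hmQ : ∫ x, x ∂Q = mQ)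
    (hvP : ∫ x, (x - mP) ^ 2 ∂P = σP ^ 2) (hvQ : ∫ x, (x - mQ) ^ 2 ∂Q = σQ ^ 2)
    (hint : Integrable (fun x => alphaIntegrand α (P.rnDeriv (P + Q) x).toReal
      (Q.rnDeriv (P + Q) x).toReal) (P + Q))
    (hac : 1 ≤ α → P ≪ Q) :
    dA α (rParam mP mQ σP σQ) (sParam mP mQ σP σQ) ≤ DA α P Q := by
  have ha : mP - mQ ≠ 0 := sub_ne_zero.2 hm
  have hPμ : P ≪ P + Q := Measure.absolutelyContinuous_of_le (Measure.le_add_right le_rfl)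
  have hQμ : Q ≪ P + Q := Measure.absolutelyContinuous_of_le (Measure.le_add_left le_rfl)
  have hσQ : 1 ≤ α → 0 < σQ ^ 2 := fun h =>
    variance_pos_of_absolutelyContinuous hQ2 hmP hm hvQ (hac h)
  have hs : 1 ≤ α → sParam mP mQ σP σQ ∈ Ioo (0 : ℝ) 1 := fun h => sParam_mem_Ioo hm (hσQ h)
  have hr01 := rParam_mem_Icc (σP := σP) (σQ := σQ) hm
  have hs01 := sParam_mem_Icc (σP := σP) (σQ := σQ) hm
  have hzero : ∀ᵐ x ∂(P + Q), 1 ≤ α → (Q.rnDeriv (P + Q) x).toReal = 0 →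
      (P.rnDeriv (P + Q) x).toReal = 0 := by
    by_cases h : 1 ≤ α
    · filter_upwards [rnDeriv_eq_zero_of_absolutelyContinuous (μ := P + Q) (hac h)] with x hx _
      exact hx
    · exact Filter.Eventually.of_forall fun x h' => absurd h' h
  have hbin := fun (A B S : ℝ) =>
    binary_sq_div (σP := σP) (σQ := σQ) hm (A := A) (B := B) (S := S)
  have hmeasP : Measurable fun x => (P.rnDeriv (P + Q) x).toReal :=
    (Measure.measurable_rnDeriv _ _).ennreal_toReal
  have hmeasQ : Measurable fun x => (Q.rnDeriv (P + Q) x).toReal :=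
    (Measure.measurable_rnDeriv _ _).ennreal_toReal
  have hhcr := fun (A B S : ℝ) => ofReal_le_lintegral_sq_div (A := A) (B := B) (S := S)
    hPμ hQμ hP2 hQ2 hmP hmQ hvP hvQ
  obtain ⟨hΦ, hDA⟩ := DA_eq_integral_alphaKernel hα.1 P Q hint
  have hΦ0 : ∀ᵐ x ∂(P + Q), 0 ≤ alphaKernel α (P.rnDeriv (P + Q) x).toReal
      (Q.rnDeriv (P + Q) x).toReal := by
    filter_upwards [hzero] with x hx
    exact alphaKernel_nonneg hα.1 ENNReal.toReal_nonneg ENNReal.toReal_nonneg hx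
  have hDA0 : 0 ≤ DA α P Q := hDA ▸ integral_nonneg_of_ae hΦ0
  rw [← ENNReal.ofReal_le_ofReal_iff hDA0, ← hDA, ofReal_integral_eq_lintegral_ofReal hΦ hΦ0,
    dA_eq_alphaKernel hα.1]
  generalize rParam mP mQ σP σQ = r at *
  generalize sParam mP mQ σP σQ = s at *
  have hbs : 1 ≤ α → s = 0 → r = 0 := fun h h' => absurd h' (hs h).1.ne'
  have hbs' : 1 ≤ α → 1 - s = 0 → 1 - r = 0 :=
    fun h h' => absurd h' (sub_pos.2 (hs h).2).ne'
  rcases hα.2.lt_or_eq with h2 | rfl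
  · have hα' : α ∈ Ioo (0 : ℝ) 2 := ⟨hα.1, h2⟩
    have hC := stieltjesConst_pos hα'
    have hC0 : ENNReal.ofReal (stieltjesConst α) ≠ 0 := (ENNReal.ofReal_pos.2 hC).ne'
    rw [← ENNReal.mul_le_mul_iff_right hC0 ENNReal.ofReal_ne_top]
    calc _ ≤ ENNReal.ofReal (stieltjesConst α) * (ENNReal.ofReal (alphaKernel α r s)
          + ENNReal.ofReal (alphaKernel α (1 - r) (1 - s))) := by
          gcongr
          exact ENNReal.ofReal_add_le
      _ = ∫⁻ u in Ioi (0 : ℝ), (ENNReal.ofReal (u ^ α / (1 + u) ^ 2 *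
            ((r - s) ^ 2 / (r + u * s))) + ENNReal.ofReal (u ^ α / (1 + u) ^ 2 *
            (((1 - r) - (1 - s)) ^ 2 / ((1 - r) + u * (1 - s))))) := by
          rw [lintegral_add_left (by fun_prop), mul_add,
            stieltjes_alphaKernel hα' hr01.1 hs01.1 hbs,
            stieltjes_alphaKernel hα' (sub_nonneg.2 hr01.2) (sub_nonneg.2 hs01.2) hbs']
      _ ≤ ∫⁻ u in Ioi (0 : ℝ), ∫⁻ x, ENNReal.ofReal (u ^ α / (1 + u) ^ 2 *
            (((P.rnDeriv (P + Q) x).toReal - (Q.rnDeriv (P + Q) x).toReal) ^ 2 /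
            ((P.rnDeriv (P + Q) x).toReal + u * (Q.rnDeriv (P + Q) x).toReal))) ∂(P + Q) := by
          refine setLIntegral_mono_ae' measurableSet_Ioi (Filter.Eventually.of_forall fun u hu => ?_)
          have hu : 0 < u := hu
          have hu1 : 0 < 1 + u := by positivity
          have hw : 0 ≤ u ^ α / (1 + u) ^ 2 := by positivity
          have hS0 : 0 < 1 * σP ^ 2 + u * σQ ^ 2 + 1 * u * (mP - mQ) ^ 2 / (1 + u) := by
            positivity
          have hr0 : 0 ≤ 1 - r := sub_nonneg.2 hr01.2
          have hs0 : 0 ≤ 1 - s := sub_nonneg.2 hs01.2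
          have hr0' := hr01.1
          have hs0' := hs01.1
          have hb := hbin 1 u _ hu1 rfl hS0
          have hl := hhcr 1 u _ zero_le_one hu.le hu1 rfl hS0 <|
            Filter.Eventually.of_forall fun x hx => by
              have h1 : 0 ≤ (P.rnDeriv (P + Q) x).toReal := ENNReal.toReal_nonneg
              have h2 : 0 ≤ (Q.rnDeriv (P + Q) x).toReal := ENNReal.toReal_nonneg
              have h3 := mul_nonneg hu.le h2
              have h4 : (P.rnDeriv (P + Q) x).toReal = 0 := by linarith
              have h5 : u * (Q.rnDeriv (P + Q) x).toReal = 0 := by linarith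
              rw [h4, (mul_eq_zero.1 h5).resolve_left hu.ne']
          simp_rw [ENNReal.ofReal_mul hw]
          rw [lintegral_const_mul _ (by fun_prop), ← mul_add,
            ← ENNReal.ofReal_add (by positivity) (by positivity)]
          simp only [one_mul] at hb hl
          rw [hb]
          gcongr
      _ = ∫⁻ x, (∫⁻ u in Ioi (0 : ℝ), ENNReal.ofReal (u ^ α / (1 + u) ^ 2 *
            (((P.rnDeriv (P + Q) x).toReal - (Q.rnDeriv (P + Q) x).toReal) ^ 2 /
            ((P.rnDeriv (P + Q) x).toReal + u * (Q.rnDeriv (P + Q) x).toReal)))) ∂(P + Q) := by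
          refine lintegral_lintegral_swap (Measurable.aemeasurable ?_)
          unfold Function.uncurry
          fun_prop
      _ = ∫⁻ x, ENNReal.ofReal (stieltjesConst α) * ENNReal.ofReal (alphaKernel α
            (P.rnDeriv (P + Q) x).toReal (Q.rnDeriv (P + Q) x).toReal) ∂(P + Q) := by
          refine lintegral_congr_ae ?_
          filter_upwards [hzero] with x hx
          exact stieltjes_alphaKernel hα' ENNReal.toReal_nonneg ENNReal.toReal_nonneg hx
      _ = _ := lintegral_const_mul' _ _ ENNReal.ofReal_ne_top
  · have h1 : (1 : ℝ) ≤ 2 := one_le_two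
    have hσ := hσQ h1
    have hS0 : 0 < 0 * σP ^ 2 + 2 * σQ ^ 2 + 0 * 2 * (mP - mQ) ^ 2 / (0 + 2) := by
      simpa using hσ
    have hb := hbin 0 2 _ (by norm_num) rfl hS0
    have hl := hhcr 0 2 _ le_rfl zero_le_two (by norm_num) rfl hS0 <| by
      filter_upwards [hzero] with x hx h0
      have h3 : (Q.rnDeriv (P + Q) x).toReal = 0 := by linarith
      rw [h3, hx h1 h3]
    simp only [zero_mul, zero_add] at hb hl
    rw [alphaKernel_two (hbs h1), alphaKernel_two (hbs' h1), hb]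
    simp only [zero_div, add_zero]  at hl ⊢
    refine hl.trans (lintegral_mono_ae ?_)
    filter_upwards [hzero] with x hx
    rw [alphaKernel_two (hx h1)]

/-- Theorem 2 (a): for `α ∈ [-1,2]` and Borel probability measures `P, Q` on `ℝ`
with finite second moments, means `m_P ≠ m_Q` and variances `σ_P², σ_Q²`,
`D_A^{(α)}(P‖Q) ≥ d_A^{(α)}(r‖s)` (whenever the divergence is well defined,
i.e. the defining integrand is integrable and, up to null sets, the relevant
absolute continuity holds). -/
theorem alpha_div_tight_lower_bound
    (α : ℝ) (hα : α ∈ Set.Icc (-1 : ℝ) 2)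
    (P Q : Measure ℝ) [IsProbabilityMeasure P] [IsProbabilityMeasure Q]
    (hP2 : Integrable (fun x => x ^ 2) P) (hQ2 : Integrable (fun x => x ^ 2) Q)
    (mP mQ σP σQ : ℝ) (hm : mP ≠ mQ) (hσP : 0 ≤ σP) (hσQ : 0 ≤ σQ)
    (hmP : ∫ x, x ∂P = mP) (hmQ : ∫ x, x ∂Q = mQ)
    (hvP : ∫ x, (x - mP) ^ 2 ∂P = σP ^ 2) (hvQ : ∫ x, (x - mQ) ^ 2 ∂Q = σQ ^ 2)
    (hint : α ≠ 0 → α ≠ 1 → Integrable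
      (fun x => (P.rnDeriv (P + Q) x).toReal ^ α * (Q.rnDeriv (P + Q) x).toReal ^ (1 - α))
      (P + Q))
    (hint1 : α = 1 → Integrable (fun x => (P.rnDeriv (P + Q) x).toReal *
      Real.log ((P.rnDeriv (P + Q) x).toReal / (Q.rnDeriv (P + Q) x).toReal)) (P + Q))
    (hint0 : α = 0 → Integrable (fun x => (Q.rnDeriv (P + Q) x).toReal *
      Real.log ((Q.rnDeriv (P + Q) x).toReal / (P.rnDeriv (P + Q) x).toReal)) (P + Q))
    (hacP : 1 ≤ α → P ≪ Q) (hacQ : α ≤ 0 → Q ≪ P) :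
    dA α (rParam mP mQ σP σQ) (sParam mP mQ σP σQ) ≤ DA α P Q := by
  rcases lt_or_ge 0 α with h0 | h0
  · refine dA_le_DA_of_pos ⟨h0, hα.2⟩ P Q hP2 hQ2 hm hmP hmQ hvP hvQ ?_ hacP
    unfold alphaIntegrand
    split_ifs with h1
    · exact hint1 h1
    · exact hint h0.ne' h1
  rw [← DA_swap, ← dA_swap, ← rParam_swap hm, ← sParam_swap hm]
  refine dA_le_DA_of_pos ⟨by linarith, by linarith [hα.1]⟩ Q P hQ2 hP2 hm.symm hmQ hmP hvQ hvP ?_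
    fun _ => hacQ h0
  rw [add_comm Q P]
  unfold alphaIntegrand
  split_ifs with h1
  · exact hint0 (by linarith)
  · simp_rw [sub_sub_cancel, mul_comm (_ ^ (1 - α))]
    exact hint (fun h => h1 (by linarith)) (by linarith)
end

section
/- Let α ∈ ℝ, let m ∈ ℝ, and let σ_P, σ_Q > 0. Then the infimum of D_A^{(α)}(P‖Q) over all pairs (P, Q) of Borel probability measures on ℝ both having mean m and having variances σ_P² and σ_Q² respectively is equal to 0; that is, for every ε > 0 there exist such P, Q with D_A^{(α)}(P‖Q) < ε. -/
open MeasureTheory Real Set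

/-- The Radon–Nikodym density at an atom of the dominating measure is the ratio of the masses. -/
lemma toReal_rnDeriv_eq_div_singleton {P ν : Measure ℝ} [IsFiniteMeasure P] [IsFiniteMeasure ν]
    (h : P ≪ ν) {x : ℝ} (hx : ν.real {x} ≠ 0) :
    (P.rnDeriv ν x).toReal = P.real {x} / ν.real {x} := by
  rw [eq_div_iff hx]
  have key := Measure.setLIntegral_rnDeriv h {x}
  rw [lintegral_singleton] at key
  rw [Measure.real, Measure.real, ← ENNReal.toReal_mul, key]

/-- The symmetric law on `{m - t, m, m + t}` putting mass `w` outside its centre `m`. -/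
noncomputable def symmThreePoint (m t w : ℝ) : Measure ℝ :=
  ENNReal.ofReal (1 - w) • Measure.dirac m +
    (ENNReal.ofReal (w / 2) • Measure.dirac (m - t) +
      ENNReal.ofReal (w / 2) • Measure.dirac (m + t))

instance (m t w : ℝ) : IsFiniteMeasure (symmThreePoint m t w) := by
  have h (r x : ℝ) : IsFiniteMeasure (ENNReal.ofReal r • Measure.dirac x) :=
    Measure.smul_finite _ ENNReal.ofReal_ne_top
  unfold symmThreePoint
  infer_instance

lemma integrable_smul_dirac (f : ℝ → ℝ) (r x : ℝ) :
    Integrable f (ENNReal.ofReal r • Measure.dirac x) :=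
  (integrable_dirac (by simp)).smul_measure ENNReal.ofReal_ne_top

lemma integrable_symmThreePoint (m t w : ℝ) (f : ℝ → ℝ) :
    Integrable f (symmThreePoint m t w) :=
  (integrable_smul_dirac ..).add_measure
    ((integrable_smul_dirac ..).add_measure (integrable_smul_dirac ..))

lemma integral_symmThreePoint {w : ℝ} (m t : ℝ) (h0 : 0 ≤ w) (h1 : w ≤ 1) (f : ℝ → ℝ) :
    ∫ x, f x ∂symmThreePoint m t w =
      (1 - w) * f m + (w / 2 * f (m - t) + w / 2 * f (m + t)) := by
  unfold symmThreePoint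
  rw [integral_add_measure (integrable_smul_dirac ..)
      ((integrable_smul_dirac ..).add_measure (integrable_smul_dirac ..)),
    integral_add_measure (integrable_smul_dirac ..) (integrable_smul_dirac ..)]
  simp only [integral_smul_measure, integral_dirac, smul_eq_mul,
    ENNReal.toReal_ofReal (sub_nonneg.2 h1), ENNReal.toReal_ofReal (div_nonneg h0 zero_le_two)]

lemma real_symmThreePoint_singleton {w : ℝ} (m t : ℝ) (h0 : 0 ≤ w) (h1 : w ≤ 1) (x : ℝ) :
    (symmThreePoint m t w).real {x} =
      (1 - w) * ({x} : Set ℝ).indicator 1 m +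
        (w / 2 * ({x} : Set ℝ).indicator 1 (m - t) + w / 2 * ({x} : Set ℝ).indicator 1 (m + t)) := by
  rw [← integral_symmThreePoint m t h0 h1 (({x} : Set ℝ).indicator 1),
    integral_indicator_one (measurableSet_singleton x)]

lemma isProbabilityMeasure_symmThreePoint {w : ℝ} (m t : ℝ) (h0 : 0 ≤ w) (h1 : w ≤ 1) :
    IsProbabilityMeasure (symmThreePoint m t w) := by
  have h := integral_symmThreePoint m t h0 h1 (fun _ => 1)
  rw [integral_const, smul_eq_mul, mul_one] at h
  refine ⟨?_⟩
  rw [← ENNReal.toReal_eq_one_iff]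
  exact h.trans (by ring)

/-- The divergence of two symmetric three-point laws is a binary divergence. -/
lemma DA_symmThreePoint {p q t : ℝ} (α m : ℝ) (ht : 0 < t) (hp : 0 < p) (hp1 : p < 1)
    (hq : 0 < q) (hq1 : q < 1) :
    DA α (symmThreePoint m t p) (symmThreePoint m t q) = dA α p q := by
  set P := symmThreePoint m t p
  set Q := symmThreePoint m t q
  have hint (f : ℝ → ℝ) : ∫ x, f x ∂(P + Q) =
      (1 - p) * f m + (p / 2 * f (m - t) + p / 2 * f (m + t)) +
      ((1 - q) * f m + (q / 2 * f (m - t) + q / 2 * f (m + t))) := by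
    rw [integral_add_measure (integrable_symmThreePoint ..) (integrable_symmThreePoint ..),
      integral_symmThreePoint m t hp.le hp1.le, integral_symmThreePoint m t hq.le hq1.le]
  have hPν : P ≪ P + Q := Measure.absolutelyContinuous_of_le (Measure.le_add_right le_rfl)
  have hQν : Q ≪ P + Q := Measure.absolutelyContinuous_of_le (Measure.le_add_left le_rfl)
  have hadd (x : ℝ) : (P + Q).real {x} = P.real {x} + Q.real {x} := measureReal_add_apply
  have e1 : m - t ≠ m := by linarith
  have e2 : m + t ≠ m := by linarith
  have e3 : m - t ≠ m + t := by linarith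
  have mass {w : ℝ} (h0 : 0 < w) (h1 : w < 1) :
      (symmThreePoint m t w).real {m} = 1 - w ∧ (symmThreePoint m t w).real {m - t} = w / 2 ∧
        (symmThreePoint m t w).real {m + t} = w / 2 := by
    refine ⟨?_, ?_, ?_⟩ <;> rw [real_symmThreePoint_singleton m t h0.le h1.le] <;>
      simp [e1, e2, e3, e1.symm, e2.symm, e3.symm]
  obtain ⟨p1, p2, p3⟩ := mass hp hp1
  obtain ⟨q1, q2, q3⟩ := mass hq hq1
  have dens {x a b : ℝ} (ha : 0 < a) (hb : 0 < b) (hPx : P.real {x} = a) (hQx : Q.real {x} = b) :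
      (P.rnDeriv (P + Q) x).toReal = a / (a + b) ∧
        (Q.rnDeriv (P + Q) x).toReal = b / (a + b) := by
    have hne : (P + Q).real {x} ≠ 0 := by rw [hadd, hPx, hQx]; positivity
    rw [toReal_rnDeriv_eq_div_singleton hPν hne, toReal_rnDeriv_eq_div_singleton hQν hne,
      hadd, hPx, hQx]
    exact ⟨rfl, rfl⟩
  have hp' : 0 < 1 - p := by linarith
  have hq' : 0 < 1 - q := by linarith
  obtain ⟨d1, d1'⟩ := dens hp' hq' p1 q1
  obtain ⟨d2, d2'⟩ := dens (half_pos hp) (half_pos hq) p2 q2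
  obtain ⟨d3, d3'⟩ := dens (half_pos hp) (half_pos hq) p3 q3
  have hlog {a b : ℝ} (ha : 0 < a) (hb : 0 < b) :
      (a + b) * (a / (a + b) * log (a / (a + b) / (b / (a + b)))) = a * log (a / b) := by
    rw [div_div_div_cancel_right₀ (by positivity)]
    field_simp
  have hpow {a b : ℝ} (ha : 0 < a) (hb : 0 < b) :
      (a + b) * ((a / (a + b)) ^ α * (b / (a + b)) ^ (1 - α)) = a ^ α * b ^ (1 - α) := by
    have hab : 0 < a + b := by positivity
    rw [div_rpow ha.le hab.le, div_rpow hb.le hab.le, rpow_sub hab, rpow_one]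
    have := rpow_pos_of_pos hab α
    field_simp
  have hhalf : p / 2 / (q / 2) = p / q := div_div_div_cancel_right₀ two_ne_zero ..
  have hhalf' : q / 2 / (p / 2) = q / p := div_div_div_cancel_right₀ two_ne_zero ..
  have hhpow : (p / 2) ^ α * (q / 2) ^ (1 - α) = p ^ α * q ^ (1 - α) / 2 := by
    rw [div_rpow hp.le zero_le_two, div_rpow hq.le zero_le_two, rpow_sub two_pos, rpow_one]
    have := rpow_pos_of_pos two_pos α
    field_simp
  unfold DA dA
  split_ifs with h0 h1
  · rw [hint, d1, d1', d2, d2', d3, d3']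
    have k1 := hlog hq' hp'
    have k2 := hlog (half_pos hq) (half_pos hp)
    rw [hhalf'] at k2
    rw [add_comm (1 - p), add_comm (p / 2)]
    linear_combination k1 + 2 * k2
  · rw [hint, d1, d1', d2, d2', d3, d3']
    have k1 := hlog hp' hq'
    have k2 := hlog (half_pos hp) (half_pos hq)
    rw [hhalf] at k2
    linear_combination k1 + 2 * k2
  · rw [hint, d1, d1', d2, d2', d3, d3']
    have k1 := hpow hp' hq'
    have k2 := hpow (half_pos hp) (half_pos hq)
    rw [hhpow] at k2
    linear_combination (α * (α - 1))⁻¹ * (k1 + 2 * k2)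

open Filter Topology in
/-- The binary divergence vanishes as both arguments tend to `0` at proportional rates. -/
lemma tendsto_dA_mul_zero {a b : ℝ} (α : ℝ) (ha : 0 < a) (hb : 0 < b) :
    Tendsto (fun u => dA α (a * u) (b * u)) (𝓝[>] 0) (𝓝 0) := by
  have hc (c : ℝ) : ContinuousAt (fun u : ℝ => 1 - c * u) 0 := by fun_prop
  have hlim {f : ℝ → ℝ} (hf : ContinuousAt f 0) (h0 : f 0 = 0)
      (h : ∀ u > 0, f u = dA α (a * u) (b * u)) :
      Tendsto (fun u => dA α (a * u) (b * u)) (𝓝[>] 0) (𝓝 0) := by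
    rw [ContinuousAt, h0] at hf
    exact (hf.mono_left nhdsWithin_le_nhds).congr'
      (eventually_nhdsWithin_of_forall fun u hu => h u hu)
  unfold dA at *
  split_ifs at * with h0 h1
  · refine hlim (f := fun u => b * u * log (b / a) + (1 - b * u) * log ((1 - b * u) / (1 - a * u)))
      ?_ (by simp) fun u hu => ?_
    · refine ContinuousAt.add (by fun_prop) ((hc b).mul (((hc b).div (hc a) ?_).log ?_)) <;> simp
    · rw [mul_div_mul_right _ _ (ne_of_gt hu)]
  · refine hlim (f := fun u => a * u * log (a / b) + (1 - a * u) * log ((1 - a * u) / (1 - b * u)))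
      ?_ (by simp) fun u hu => ?_
    · refine ContinuousAt.add (by fun_prop) ((hc a).mul (((hc a).div (hc b) ?_).log ?_)) <;> simp
    · rw [mul_div_mul_right _ _ (ne_of_gt hu)]
  · refine hlim (f := fun u => (α * (α - 1))⁻¹ *
      (a ^ α * b ^ (1 - α) * u + (1 - a * u) ^ α * (1 - b * u) ^ (1 - α) - 1))
      ?_ (by simp) fun u hu => ?_
    · refine continuousAt_const.mul (ContinuousAt.sub (ContinuousAt.add (by fun_prop)
        (((hc a).rpow_const ?_).mul ((hc b).rpow_const ?_))) continuousAt_const) <;> simp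
    · have hu' : (0 : ℝ) < u := hu
      have := rpow_pos_of_pos hu' α
      rw [mul_rpow ha.le hu'.le, mul_rpow hb.le hu'.le, rpow_sub hu', rpow_one]
      field_simp

/-- Theorem 2 (c): for any `α ∈ ℝ`, `m ∈ ℝ` and `σ_P, σ_Q > 0`, the infimum of
`D_A^{(α)}(P‖Q)` over pairs of Borel probability measures on `ℝ` with equal
means `m` and variances `σ_P², σ_Q²` is `0`: for every `ε > 0` there exist such
`P, Q` with `D_A^{(α)}(P‖Q) < ε`. -/
theorem alpha_div_equal_means_inf_zero
    (α m σP σQ : ℝ) (hσP : 0 < σP) (hσQ : 0 < σQ) (ε : ℝ) (hε : 0 < ε) :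
    ∃ P Q : Measure ℝ,
      IsProbabilityMeasure P ∧ IsProbabilityMeasure Q ∧
      Integrable (fun x => x ^ 2) P ∧ Integrable (fun x => x ^ 2) Q ∧
      ∫ x, x ∂P = m ∧ ∫ x, x ∂Q = m ∧
      ∫ x, (x - m) ^ 2 ∂P = σP ^ 2 ∧ ∫ x, (x - m) ^ 2 ∂Q = σQ ^ 2 ∧
      DA α P Q < ε := by
  have hev := (tendsto_dA_mul_zero α (pow_pos hσP 2) (pow_pos hσQ 2)).eventually_lt_const hε
  have hsmall (c : ℝ) : ∀ᶠ u in nhdsWithin (0 : ℝ) (Ioi 0), c * u < 1 := by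
    have h : ContinuousAt (fun u : ℝ => c * u) 0 := by fun_prop
    exact (h.tendsto.mono_left nhdsWithin_le_nhds).eventually_lt_const (by simp)
  obtain ⟨u, ⟨⟨hu, hp⟩, hq⟩, hu0⟩ :=
    (((hev.and (hsmall (σP ^ 2))).and (hsmall (σQ ^ 2))).and self_mem_nhdsWithin).exists
  have hu0 : 0 < u := hu0
  have hp0 : 0 < σP ^ 2 * u := by positivity
  have hq0 : 0 < σQ ^ 2 * u := by positivity
  set t := (√u)⁻¹ with ht
  have ht0 : 0 < t := inv_pos.2 (sqrt_pos.2 hu0)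
  have htu : u * t ^ 2 = 1 := by
    rw [ht, inv_pow, sq_sqrt hu0.le, mul_inv_cancel₀ hu0.ne']
  refine ⟨symmThreePoint m t (σP ^ 2 * u), symmThreePoint m t (σQ ^ 2 * u),
    isProbabilityMeasure_symmThreePoint m t hp0.le hp.le,
    isProbabilityMeasure_symmThreePoint m t hq0.le hq.le,
    integrable_symmThreePoint .., integrable_symmThreePoint .., ?_, ?_, ?_, ?_, ?_⟩
  · rw [integral_symmThreePoint m t hp0.le hp.le]; ring
  · rw [integral_symmThreePoint m t hq0.le hq.le]; ring
  · rw [integral_symmThreePoint m t hp0.le hp.le]; linear_combination σP ^ 2 * htu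
  · rw [integral_symmThreePoint m t hq0.le hq.le]; linear_combination σQ ^ 2 * htu
  · rwa [DA_symmThreePoint α m ht0 hp0 hp hq0 hq]
end

section
/- Let α ∈ (0,1) and fix m_P ≠ m_Q. Define, for σ_P, σ_Q > 0, the quantities a, v, r, s as in the context and set g(σ_P, σ_Q) := d_A^{(α)}(r‖s). Then g is strictly decreasing in σ_P for each fixed σ_Q > 0, and strictly decreasing in σ_Q for each fixed σ_P > 0. -/
open MeasureTheory Real Set

/-- The binary `α`-divergence `d_A^{(α)}(r‖s)` for `α ∈ (0,1)`, as a function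
`g` of the standard deviations `σ_P, σ_Q` (means `m_P ≠ m_Q` fixed). -/
noncomputable def g (α mP mQ σP σQ : ℝ) : ℝ :=
  (α * (α - 1))⁻¹ *
    (rParam mP mQ σP σQ ^ α * sParam mP mQ σP σQ ^ (1 - α)
      + (1 - rParam mP mQ σP σQ) ^ α * (1 - sParam mP mQ σP σQ) ^ (1 - α) - 1)

/-- The weight with which `t ^ (α - 1)` is integrated to give the `α`-affinity of two binary
distributions on the same two points, with variances `p`, `q` and means at distance `|a|`. -/
noncomputable def affinityKernel (a p q t : ℝ) : ℝ :=
  (p + t * q) / ((p + t * q) * (1 + t) + t * a ^ 2)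

lemma affinityKernel_lt {a p q p' q' t : ℝ} (ha : a ≠ 0) (ht : 0 < t) (hp : 0 < p) (hq : 0 < q)
    (hp' : 0 < p') (hq' : 0 < q') (h : p + t * q < p' + t * q') :
    affinityKernel a p q t < affinityKernel a p' q' t := by
  unfold affinityKernel
  rw [div_lt_div_iff₀ (by positivity) (by positivity)]
  have := mul_lt_mul_of_pos_right h (show 0 < t * a ^ 2 by positivity)
  linarith

lemma rpow_mul_rpow_eq_integral {α x y : ℝ} (hα : α ∈ Ioo (0 : ℝ) 1) (hx : 0 < x) (hy : 0 < y) :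
    IntegrableOn (fun t => t ^ (α - 1) * (x * y / (x + t * y))) (Ioi 0) ∧
      x ^ α * y ^ (1 - α) = (∫ t in Ioi 0, rpowIntegrand₀₁ α t 1)⁻¹ *
        ∫ t in Ioi 0, t ^ (α - 1) * (x * y / (x + t * y)) := by
  have hxy : 0 ≤ x / y := by positivity
  have hcongr : EqOn (fun t => y * rpowIntegrand₀₁ α t (x / y))
      (fun t => t ^ (α - 1) * (x * y / (x + t * y))) (Ioi 0) := by
    intro t (ht : 0 < t)
    simp only [rpowIntegrand₀₁_eq_pow_div hα ht.le hxy]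
    rw [mul_div_assoc, mul_left_comm]
    congr 1
    field_simp
    ring
  refine ⟨IntegrableOn.congr_fun ((integrableOn_rpowIntegrand₀₁_Ioi hα hxy).const_mul y) hcongr
    measurableSet_Ioi, ?_⟩
  rw [← setIntegral_congr_fun measurableSet_Ioi hcongr, integral_const_mul, mul_left_comm,
    ← rpow_eq_const_mul_integral hα hxy, div_rpow hx.le hy.le, rpow_sub hy, rpow_one]
  ring

lemma binary_affinityKernel_eq {r s t a D : ℝ} (hr : r ∈ Ioo (0 : ℝ) 1) (hs : s ∈ Ioo (0 : ℝ) 1)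
    (ht : 0 < t) (hD : 0 < D) (hrs : (r - s) ^ 2 * D ^ 2 = a ^ 2) :
    r * s / (r + t * s) + (1 - r) * (1 - s) / ((1 - r) + t * (1 - s)) =
      affinityKernel a (r * (1 - r) * D ^ 2) (s * (1 - s) * D ^ 2) t := by
  obtain ⟨hr₀, hr₁⟩ := hr
  obtain ⟨hs₀, hs₁⟩ := hs
  rw [← sub_pos] at hr₁ hs₁
  have h₁ : 0 < r + t * s := by positivity
  have h₂ : 0 < (1 - r) + t * (1 - s) := by positivity
  have hden : (r * (1 - r) * D ^ 2 + t * (s * (1 - s) * D ^ 2)) * (1 + t) + t * a ^ 2 =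
      D ^ 2 * ((r + t * s) * ((1 - r) + t * (1 - s))) := by
    rw [← hrs]; ring
  rw [affinityKernel, hden, div_add_div _ _ h₁.ne' h₂.ne', div_eq_div_iff (by positivity)
    (by positivity)]
  ring

lemma rParam_sParam_spec {mP mQ σP σQ : ℝ} (hm : mP ≠ mQ) (hP : 0 < σP) (hQ : 0 < σQ) :
    ∃ D : ℝ, 0 < D ∧
      (rParam mP mQ σP σQ - sParam mP mQ σP σQ) ^ 2 * D ^ 2 = (mP - mQ) ^ 2 ∧
      rParam mP mQ σP σQ * (1 - rParam mP mQ σP σQ) * D ^ 2 = σP ^ 2 ∧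
      sParam mP mQ σP σQ * (1 - sParam mP mQ σP σQ) * D ^ 2 = σQ ^ 2 := by
  have ha : mP - mQ ≠ 0 := sub_ne_zero.2 hm
  unfold rParam sParam
  set a := mP - mQ with ha_def
  have hpos : 0 < (σQ ^ 2 - σP ^ 2) ^ 2 + 2 * a ^ 2 * (σP ^ 2 + σQ ^ 2) + a ^ 4 := by positivity
  have hv : 0 < vParam mP mQ σP σQ := by
    unfold vParam
    have := Real.sqrt_pos.2 hpos
    positivity
  have hsq : 4 * a ^ 2 * vParam mP mQ σP σQ ^ 2 =
      (σQ ^ 2 - σP ^ 2) ^ 2 + 2 * a ^ 2 * (σP ^ 2 + σQ ^ 2) + a ^ 4 := by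
    unfold vParam
    rw [← ha_def, mul_pow, Real.sq_sqrt hpos.le, div_pow, mul_pow, sq_abs]
    field_simp
    ring
  set v := vParam mP mQ σP σQ
  refine ⟨2 * v, by positivity, ?_, ?_, ?_⟩
  · field_simp
    ring
  · field_simp
    linear_combination 4 * hsq
  · field_simp
    linear_combination 4 * hsq

lemma mem_Ioo_of_mul_one_sub_pos {x : ℝ} (h : 0 < x * (1 - x)) : x ∈ Ioo (0 : ℝ) 1 := by
  constructor <;> nlinarith [sq_nonneg x, sq_nonneg (1 - x)]

lemma g_eq_integral {α mP mQ σP σQ : ℝ} (hα : α ∈ Ioo (0 : ℝ) 1) (hm : mP ≠ mQ) (hP : 0 < σP)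
    (hQ : 0 < σQ) :
    IntegrableOn (fun t => t ^ (α - 1) * affinityKernel (mP - mQ) (σP ^ 2) (σQ ^ 2) t) (Ioi 0) ∧
      g α mP mQ σP σQ = (α * (α - 1))⁻¹ * ((∫ t in Ioi 0, rpowIntegrand₀₁ α t 1)⁻¹ *
        (∫ t in Ioi 0, t ^ (α - 1) * affinityKernel (mP - mQ) (σP ^ 2) (σQ ^ 2) t) - 1) := by
  obtain ⟨D, hD, hrs, hr, hs⟩ := rParam_sParam_spec hm hP hQ
  unfold g
  set r := rParam mP mQ σP σQ
  set s := sParam mP mQ σP σQ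
  have hr_mem : r ∈ Ioo (0 : ℝ) 1 := mem_Ioo_of_mul_one_sub_pos <|
    pos_of_mul_pos_left (hr ▸ pow_pos hP 2) (sq_nonneg D)
  have hs_mem : s ∈ Ioo (0 : ℝ) 1 := mem_Ioo_of_mul_one_sub_pos <|
    pos_of_mul_pos_left (hs ▸ pow_pos hQ 2) (sq_nonneg D)
  obtain ⟨hint, heq⟩ := rpow_mul_rpow_eq_integral hα hr_mem.1 hs_mem.1
  obtain ⟨hint', heq'⟩ :=
    rpow_mul_rpow_eq_integral hα (sub_pos.2 hr_mem.2) (sub_pos.2 hs_mem.2)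
  have hcongr : EqOn (fun t => t ^ (α - 1) * (r * s / (r + t * s)) +
      t ^ (α - 1) * ((1 - r) * (1 - s) / ((1 - r) + t * (1 - s))))
      (fun t => t ^ (α - 1) * affinityKernel (mP - mQ) (σP ^ 2) (σQ ^ 2) t) (Ioi 0) := by
    intro t ht
    simp only [← mul_add]
    rw [binary_affinityKernel_eq hr_mem hs_mem ht hD hrs, hr, hs]
  refine ⟨(hint.add hint').congr_fun hcongr measurableSet_Ioi, ?_⟩
  rw [← setIntegral_congr_fun measurableSet_Ioi hcongr, integral_add hint hint', mul_add,
    ← heq, ← heq']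

lemma setIntegral_lt_setIntegral_of_forall_lt {X : Type*} [MeasurableSpace X] {μ : Measure X}
    {S : Set X} {f h : X → ℝ} (hS : MeasurableSet S) (hμ : 0 < μ S) (hf : IntegrableOn f S μ)
    (hh : IntegrableOn h S μ) (hlt : ∀ x ∈ S, f x < h x) :
    ∫ x in S, f x ∂μ < ∫ x in S, h x ∂μ := by
  rw [← sub_pos, ← integral_sub' hh hf, setIntegral_pos_iff_support_of_nonneg_ae _ (hh.sub hf)]
  · rwa [inter_eq_self_of_subset_right]
    intro x hx
    exact (sub_pos.2 (hlt x hx)).ne'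
  · filter_upwards [ae_restrict_mem hS] with x hx
    exact sub_nonneg.2 (hlt x hx).le

lemma g_lt_g {α mP mQ σP σQ σP' σQ' : ℝ} (hα : α ∈ Ioo (0 : ℝ) 1) (hm : mP ≠ mQ) (hP : 0 < σP)
    (hQ : 0 < σQ) (hP' : 0 < σP') (hQ' : 0 < σQ')
    (hlt : ∀ t : ℝ, 0 < t → σP ^ 2 + t * σQ ^ 2 < σP' ^ 2 + t * σQ' ^ 2) :
    g α mP mQ σP' σQ' < g α mP mQ σP σQ := by
  obtain ⟨hint, heq⟩ := g_eq_integral hα hm hP hQ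
  obtain ⟨hint', heq'⟩ := g_eq_integral hα hm hP' hQ'
  have hI : ∫ t in Ioi 0, t ^ (α - 1) * affinityKernel (mP - mQ) (σP ^ 2) (σQ ^ 2) t <
      ∫ t in Ioi 0, t ^ (α - 1) * affinityKernel (mP - mQ) (σP' ^ 2) (σQ' ^ 2) t := by
    refine setIntegral_lt_setIntegral_of_forall_lt measurableSet_Ioi (by simp) hint hint' ?_
    intro t (ht : 0 < t)
    exact mul_lt_mul_of_pos_left (affinityKernel_lt (sub_ne_zero.2 hm) ht (by positivity)
      (by positivity) (by positivity) (by positivity) (hlt t ht)) (rpow_pos_of_pos ht _)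
  rw [heq, heq']
  have hneg : (α * (α - 1))⁻¹ < 0 :=
    inv_lt_zero.2 (mul_neg_of_pos_of_neg hα.1 (sub_neg.2 hα.2))
  exact mul_lt_mul_of_neg_left (sub_lt_sub_right (mul_lt_mul_of_pos_left hI
    (inv_pos.2 (integral_rpowIntegrand₀₁_one_pos hα))) 1) hneg

/-- Lemma 2: for `α ∈ (0,1)` and fixed means `m_P ≠ m_Q`, the binary
`α`-divergence `g(σ_P, σ_Q) = d_A^{(α)}(r‖s)` is strictly decreasing in `σ_P`
for each fixed `σ_Q > 0`, and strictly decreasing in `σ_Q` for each fixed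
`σ_P > 0`. -/
theorem binary_alpha_div_strictly_decreasing
    (α : ℝ) (hα : α ∈ Set.Ioo (0 : ℝ) 1) (mP mQ : ℝ) (hm : mP ≠ mQ) :
    (∀ σQ : ℝ, 0 < σQ →
      StrictAntiOn (fun σP => g α mP mQ σP σQ) (Set.Ioi 0)) ∧
    (∀ σP : ℝ, 0 < σP →
      StrictAntiOn (fun σQ => g α mP mQ σP σQ) (Set.Ioi 0)) := by
  refine ⟨fun σQ hQ σP hP σP' hP' h => g_lt_g hα hm hP hQ hP' hQ fun t _ => ?_,
    fun σP hP σQ hQ σQ' hQ' h => g_lt_g hα hm hP hQ hP hQ' fun t ht => ?_⟩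
  · exact add_lt_add_left (pow_lt_pow_left₀ h (le_of_lt hP) two_ne_zero) _
  · exact add_lt_add_right
      (mul_lt_mul_of_pos_left (pow_lt_pow_left₀ h (le_of_lt hQ) two_ne_zero) ht) _
end

section
/- Let 0 < α < 1. If 0 < x ≤ 1 then (1 − αx)(1 + x)^α > (1 + αx)(1 − x)^α, and if −1 ≤ x < 0 then (1 − αx)(1 + x)^α < (1 + αx)(1 − x)^α. -/
open Real

/-- For `0 < α < 1` and `0 < x < 1`, the logarithm of `(1 + α x) / (1 - α x)` is less than `α` times
that of `(1 + x) / (1 - x)`, by termwise comparison of power series. -/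
lemma log_one_add_mul_sub_log_lt {α x : ℝ} (hα0 : 0 < α) (hα1 : α < 1) (hx0 : 0 < x)
    (hx1 : x < 1) :
    log (1 + α * x) - log (1 - α * x) < α * (log (1 + x) - log (1 - x)) := by
  have hαx0 : 0 < α * x := mul_pos hα0 hx0
  have hαx1 : α * x < 1 := by nlinarith
  refine hasSum_lt (i := 1) (fun k ↦ ?_) ?_
    (hasSum_log_sub_log_of_abs_lt_one (abs_lt.2 ⟨by linarith, hαx1⟩))
    ((hasSum_log_sub_log_of_abs_lt_one (abs_lt.2 ⟨by linarith, hx1⟩)).mul_left α)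
  · have h : α ^ (2 * k + 1) ≤ α := pow_le_of_le_one hα0.le hα1.le (by lia)
    calc 2 * (1 / (2 * (k : ℝ) + 1)) * (α * x) ^ (2 * k + 1)
        = α ^ (2 * k + 1) * (2 * (1 / (2 * (k : ℝ) + 1)) * x ^ (2 * k + 1)) := by
          rw [mul_pow]; ring
      _ ≤ α * (2 * (1 / (2 * (k : ℝ) + 1)) * x ^ (2 * k + 1)) := by gcongr
  · have h : α ^ 3 < α := by nlinarith [mul_pos hα0 (sub_pos.2 hα1), sq_nonneg α]
    have hx3 : 0 < x ^ 3 := by positivity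
    norm_num [mul_pow]
    nlinarith

lemma one_add_mul_mul_rpow_lt {α x : ℝ} (hα0 : 0 < α) (hα1 : α < 1) (hx0 : 0 < x) (hx1 : x ≤ 1) :
    (1 + α * x) * (1 - x) ^ α < (1 - α * x) * (1 + x) ^ α := by
  have hαx0 : 0 < α * x := mul_pos hα0 hx0
  have h_minus : 0 < 1 - α * x := by nlinarith
  have h_plus : 0 < 1 + α * x := by linarith
  have hpow : 0 < (1 + x) ^ α := rpow_pos_of_pos (by linarith) α
  rcases hx1.eq_or_lt with rfl | hx1
  · rw [sub_self, zero_rpow hα0.ne', mul_zero]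
    exact mul_pos h_minus hpow
  · have h1 : 0 < 1 - x := sub_pos.2 hx1
    have hpow' : 0 < (1 - x) ^ α := rpow_pos_of_pos h1 α
    rw [← log_lt_log_iff (mul_pos h_plus hpow') (mul_pos h_minus hpow),
      log_mul h_plus.ne' hpow'.ne', log_mul h_minus.ne' hpow.ne', log_rpow h1,
      log_rpow (by linarith)]
    linarith [log_one_add_mul_sub_log_lt hα0 hα1 hx0 hx1]

/-- Lemma 5: for `0 < α < 1`, if `0 < x ≤ 1` then
`(1 − αx)(1 + x)^α > (1 + αx)(1 − x)^α`, and if `−1 ≤ x < 0` then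
`(1 − αx)(1 + x)^α < (1 + αx)(1 − x)^α` (real powers, with `0^α = 0`). -/
theorem alpha_power_inequality (α x : ℝ) (hα0 : 0 < α) (hα1 : α < 1) :
    (0 < x → x ≤ 1 → (1 + α * x) * (1 - x) ^ α < (1 - α * x) * (1 + x) ^ α) ∧
    (-1 ≤ x → x < 0 → (1 - α * x) * (1 + x) ^ α < (1 + α * x) * (1 - x) ^ α) := by
  refine ⟨one_add_mul_mul_rpow_lt hα0 hα1, fun hx1 hx0 ↦ ?_⟩
  have h := one_add_mul_mul_rpow_lt hα0 hα1 (neg_pos.2 hx0) (neg_le.1 hx1)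
  simpa only [mul_neg, sub_neg_eq_add, ← sub_eq_add_neg] using h
end

section
/- Fix m_P ≠ m_Q and σ_P, σ_Q > 0, and define a, v, r, s as in the context. Then the binary Hellinger quantity satisfies d_A^{(1/2)}(r‖s) = 4( 1 − √( (σ_P+σ_Q)² / (a² + (σ_P+σ_Q)²) ) ). -/
open MeasureTheory Real Set

lemma sqrt_add_sqrt_eq_sqrt {A B c : ℝ} (hA : 0 ≤ A) (hB : 0 ≤ B) (hc : 0 ≤ c)
    (h : A * B = c ^ 2) : √A + √B = √(A + B + 2 * c) := by
  have hAB : √A * √B = c := by rw [← Real.sqrt_mul hA, h, Real.sqrt_sq hc]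
  rw [eq_comm, Real.sqrt_eq_iff_mul_self_eq (by positivity) (by positivity)]
  nlinarith [Real.sq_sqrt hA, Real.sq_sqrt hB]

lemma four_mul_vParam_sq {mP mQ : ℝ} (σP σQ : ℝ) (hm : mP ≠ mQ) :
    (4 * (mP - mQ) * vParam mP mQ σP σQ) ^ 2 =
      4 * ((mP - mQ) ^ 2 + (σP + σQ) ^ 2) * ((mP - mQ) ^ 2 + (σP - σQ) ^ 2) := by
  have ha : mP - mQ ≠ 0 := sub_ne_zero.mpr hm
  have hD : 0 ≤ (σQ ^ 2 - σP ^ 2) ^ 2 + 2 * (mP - mQ) ^ 2 * (σP ^ 2 + σQ ^ 2)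
      + (mP - mQ) ^ 4 := by positivity
  unfold vParam
  rw [mul_pow, mul_pow _ (√_), Real.sq_sqrt hD, div_pow, mul_pow 2 |_|, sq_abs]
  field_simp
  ring

/-- The binary Hellinger quantity: with `m_P ≠ m_Q` and `σ_P, σ_Q > 0`,
`d_A^{(1/2)}(r‖s) = 4(1 − √(rs) − √((1−r)(1−s)))
= 4(1 − √((σ_P+σ_Q)²/(a² + (σ_P+σ_Q)²)))` where `a = m_P − m_Q`. -/
theorem binary_hellinger_formula
    (mP mQ σP σQ : ℝ) (hm : mP ≠ mQ) (hσP : 0 < σP) (hσQ : 0 < σQ) :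
    4 * (1 - Real.sqrt (rParam mP mQ σP σQ * sParam mP mQ σP σQ)
          - Real.sqrt ((1 - rParam mP mQ σP σQ) * (1 - sParam mP mQ σP σQ)))
      = 4 * (1 - Real.sqrt ((σP + σQ) ^ 2 / ((mP - mQ) ^ 2 + (σP + σQ) ^ 2))) := by
  have hw := four_mul_vParam_sq σP σQ hm
  have ha : 0 < (mP - mQ) ^ 2 := by
    have := sub_ne_zero.mpr hm
    positivity
  unfold rParam sParam
  set w := 4 * (mP - mQ) * vParam mP mQ σP σQ
  generalize mP - mQ = a at *
  have hw0 : w ≠ 0 := by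
    intro h
    have : 0 < 4 * (a ^ 2 + (σP + σQ) ^ 2) * (a ^ 2 + (σP - σQ) ^ 2) := by positivity
    rw [← hw, h] at this
    norm_num at this
  have hw2 : 0 < w ^ 2 := by positivity
  set x := (σQ ^ 2 - σP ^ 2 + a ^ 2) / w with hx
  set y := (σQ ^ 2 - σP ^ 2 - a ^ 2) / w with hy
  have hx2 : 1 / 4 - x ^ 2 = 4 * a ^ 2 * σP ^ 2 / w ^ 2 := by
    rw [hx]
    field_simp
    rw [hw]
    ring
  have hy2 : 1 / 4 - y ^ 2 = 4 * a ^ 2 * σQ ^ 2 / w ^ 2 := by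
    rw [hy]
    field_simp
    rw [hw]
    ring
  have hxy : x * y = ((σQ ^ 2 - σP ^ 2) ^ 2 - a ^ 4) / w ^ 2 := by
    rw [hx, hy]
    field_simp
    ring
  obtain ⟨hx_lower, hx_upper⟩ : -(1 / 2) ≤ x ∧ x ≤ 1 / 2 := by
    have : 0 ≤ 1 / 4 - x ^ 2 := by rw [hx2]; positivity
    exact abs_le_of_sq_le_sq' (by linarith) (by norm_num)
  obtain ⟨hy_lower, hy_upper⟩ : -(1 / 2) ≤ y ∧ y ≤ 1 / 2 := by
    have : 0 ≤ 1 / 4 - y ^ 2 := by rw [hy2]; positivity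
    exact abs_le_of_sq_le_sq' (by linarith) (by norm_num)
  have hsum := sqrt_add_sqrt_eq_sqrt
    (A := (1 / 2 + x) * (1 / 2 + y)) (B := (1 - (1 / 2 + x)) * (1 - (1 / 2 + y)))
    (c := 4 * a ^ 2 * σP * σQ / w ^ 2)
    (mul_nonneg (by linarith) (by linarith)) (mul_nonneg (by linarith) (by linarith))
    (by positivity)
    (by
      calc _ = (1 / 4 - x ^ 2) * (1 / 4 - y ^ 2) := by ring
        _ = _ := by rw [hx2, hy2]; ring)
  have hC : (1 / 2 + x) * (1 / 2 + y) + (1 - (1 / 2 + x)) * (1 - (1 / 2 + y))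
      + 2 * (4 * a ^ 2 * σP * σQ / w ^ 2) = (σP + σQ) ^ 2 / (a ^ 2 + (σP + σQ) ^ 2) := by
    calc _ = 1 / 2 + 2 * (x * y) + 2 * (4 * a ^ 2 * σP * σQ / w ^ 2) := by ring
      _ = _ := by
        have h₁ : a ^ 2 + (σP + σQ) ^ 2 ≠ 0 := by positivity
        have h₂ : a ^ 2 + (σP - σQ) ^ 2 ≠ 0 := by positivity
        rw [hxy, hw]
        field_simp
        ring
  rw [hC] at hsum
  linarith
end
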